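/- Let H be an N×N hermitian Wigner matrix satisfying condition C1, and let κ > 0. Let 𝒩_{η*}(E) be the number of eigenvalues of H in [E − η*/2, E + η*/2]. There exist a universal constant c₁ > 0 and positive constants C, c, c₂ depending only on κ such that for any δ ≤ c₁κ there is a constant K_δ with: P( sup_{|E| ≤ 2−κ} |𝒩_{η*}(E)/(N η*) − ρ_sc(E)| ≥ δ ) ≤ C e^{−c δ √(N η*)} for all η* satisfying K_δ (log N)⁴/N ≤ η* ≤ c₂ κ/K_δ and all N ≥ 2. -/

import Mathlib

open MeasureTheory ProbabilityTheory
open scoped ENNReal NNReal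

noncomputable section

/-- The density of the Wigner semicircle law. -/
def rhoSC (x : ℝ) : ℝ := if |x| ≤ 2 then Real.sqrt (4 - x ^ 2) / (2 * Real.pi) else 0

/-- The Stieltjes transform of the Wigner semicircle law. -/
def mSC (z : ℂ) : ℂ := ∫ x : ℝ, (rhoSC x : ℂ) / ((x : ℂ) - z)

/-- The Stieltjes transform of the empirical eigenvalue distribution of a matrix:
`m(z) = N⁻¹ Tr (H - z)⁻¹`. -/
def stTrans {N : ℕ} (A : Matrix (Fin N) (Fin N) ℂ) (z : ℂ) : ℂ :=
  (Matrix.trace (A - z • (1 : Matrix (Fin N) (Fin N) ℂ))⁻¹) / (N : ℂ)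

open scoped Classical in
/-- The number of eigenvalues (with multiplicity) of a Hermitian matrix lying in a set `I`. -/
def eigCount {N : ℕ} {A : Matrix (Fin N) (Fin N) ℂ} (hA : A.IsHermitian) (I : Set ℝ) : ℕ :=
  (Finset.univ.filter fun i => hA.eigenvalues i ∈ I).card

/-- `ν` has a strictly positive density `h` on `ℝ² ≃ ℂ` which is either a product of two copies
of a one-variable function or radially symmetric. -/
def WignerDensityOf (ν : Measure ℂ) (h : ℝ → ℝ → ℝ) : Prop :=
  (∀ x y, 0 < h x y) ∧
  ν = (volume : Measure ℂ).withDensity (fun z => ENNReal.ofReal (h z.re z.im)) ∧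
  ((∃ hs : ℝ → ℝ, ∀ x y, h x y = hs x * hs y) ∨
   (∃ hs : ℝ → ℝ, ∀ x y, h x y = hs (x ^ 2 + y ^ 2)))

/-- Condition C1, with explicit constants: Gaussian moments of the off-diagonal law `ν`
and of the diagonal law `ν'` are bounded by `D` resp. `D'`. -/
def CondC1 (ν : Measure ℂ) (ν' : Measure ℝ) (δ₀ D D' : ℝ) : Prop :=
  0 < δ₀ ∧
  (∫⁻ z, ENNReal.ofReal (Real.exp (δ₀ * ‖z‖ ^ 2)) ∂ν) ≤ ENNReal.ofReal D ∧
  (∫⁻ x, ENNReal.ofReal (Real.exp (δ₀ * x ^ 2)) ∂ν') ≤ ENNReal.ofReal D'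

/-- `H` is an `N × N` hermitian Wigner ensemble on the probability space `(Ω, P)`:
the entries above the diagonal are i.i.d. with law `N^{-1/2} ν` where `ν` has mean zero,
variance one and a density as in `WignerDensityOf`; the diagonal entries are real i.i.d.
with law `N^{-1/2} ν'`, `ν'` of mean zero; and all these entries are independent. -/
structure IsWignerMatrix {Ω : Type} [MeasurableSpace Ω] (P : Measure Ω) (N : ℕ)
    (H : Ω → Matrix (Fin N) (Fin N) ℂ) (ν : Measure ℂ) (ν' : Measure ℝ) : Prop where
  herm : ∀ ω, (H ω).IsHermitian
  prob : IsProbabilityMeasure P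
  probν : IsProbabilityMeasure ν
  probν' : IsProbabilityMeasure ν'
  density : ∃ h, WignerDensityOf ν h
  mean : (∫ z, z ∂ν) = 0
  var : (∫ z, ‖z‖ ^ 2 ∂ν) = 1
  mean' : (∫ x, x ∂ν') = 0
  offdiag : ∀ i j : Fin N, i < j →
    P.map (fun ω => (Real.sqrt N : ℂ) * H ω i j) = ν
  diag : ∀ i : Fin N, P.map (fun ω => Real.sqrt N * (H ω i i).re) = ν'
  diag_real : ∀ ω i, (H ω i i).im = 0
  indep : iIndepFun
    (fun (p : {p : Fin N × Fin N // p.1 ≤ p.2}) (ω : Ω) => H ω p.1.1 p.1.2) P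
/-- The Fourier transform on `ℝ²` of a real function of two variables. -/
def fourier2 (f : ℝ → ℝ → ℝ) (t s : ℝ) : ℂ :=
  ∫ x : ℝ, ∫ y : ℝ, Complex.exp (-Complex.I * (t * x + s * y)) * (f x y : ℂ)

/-- The Laplacian of a function of two real variables. -/
def laplacian2 (g : ℝ → ℝ → ℝ) (x y : ℝ) : ℝ :=
  deriv (deriv (fun t => g t y)) x + deriv (deriv (fun t => g x t)) y

/-- Condition C2 with exponent `a` and constants `w`, `w'`: decay of the Fourier transforms
of the density `h` and of `h · Δ(-log h)`. -/
def CondC2 (h : ℝ → ℝ → ℝ) (a : ℕ) (w w' : ℝ) : Prop :=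
  0 < w ∧ 0 < w' ∧
  (∀ t s : ℝ, ‖fourier2 h t s‖ ≤ 1 / (1 + w * (t ^ 2 + s ^ 2)) ^ a) ∧
  (∀ t s : ℝ, ‖fourier2
      (fun x y => h x y * laplacian2 (fun u v => -Real.log (h u v)) x y) t s‖
    ≤ 1 / (1 + w' * (t ^ 2 + s ^ 2)) ^ a)

/-- Either the real and imaginary parts under `ν` are i.i.d., or `ν` is rotationally
symmetric. -/
def ComplexSymm (ν : Measure ℂ) : Prop :=
  (∃ μ₀ : Measure ℝ,
    ν = Measure.map (fun p : ℝ × ℝ => (p.1 : ℂ) + p.2 * Complex.I) (μ₀.prod μ₀)) ∨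
  (∀ θ : ℝ, Measure.map (fun z => Complex.exp (θ * Complex.I) * z) ν = ν)
open MeasureTheory ProbabilityTheory
open scoped ENNReal NNReal
noncomputable section

/-- Sub-Gaussian type condition for one entry. -/
def SGc (ν : Measure ℂ) (C c0 : ℝ) : Prop := ∀ (a : ℝ) (w : ℂ), |a| ≤ c0 →
  ∫⁻ z, ENNReal.ofReal (Real.exp (a * (‖z‖ ^ 2 - 1) + 2 * (star z * w).re)) ∂ν
    ≤ ENNReal.ofReal (Real.exp (C * (a ^ 2 + ‖w‖ ^ 2)))

lemma exp_le_quad (x : ℝ) : Real.exp x ≤ 1 + x + x ^ 2 * Real.exp |x| := by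
  have h := Complex.norm_exp_sub_sum_le_norm_mul_exp (x : ℂ) 2
  have e : Complex.exp x - ∑ m ∈ Finset.range 2, (x : ℂ) ^ m / (m.factorial : ℂ) = ((Real.exp x - (1 + x) : ℝ) : ℂ) := by
    simp [Finset.sum_range_succ]
  rw [e, Complex.norm_real, Complex.norm_real, Real.norm_eq_abs, Real.norm_eq_abs, sq_abs] at h
  have := (abs_le.1 h).2
  linarith

lemma SG_key (δ₀ a : ℝ) (w z : ℂ) (hδ : 0 < δ₀) (ha : |a| ≤ δ₀ / 4) (x : ℝ)
    (hx : x = a * (‖z‖ ^ 2 - 1) + 2 * (star z * w).re) :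
    x ^ 2 * Real.exp |x| ≤ 16 * (1 / δ₀ ^ 2 + 1 / δ₀) * Real.exp δ₀ * (a ^ 2 + ‖w‖ ^ 2)
      * Real.exp (4 / δ₀ * ‖w‖ ^ 2) * Real.exp (δ₀ * ‖z‖ ^ 2) := by
  set s := ‖z‖ ^ 2 + 1 with hs
  have hs0 : 0 < s := by positivity
  have hzs : ‖z‖ ^ 2 ≤ s := by linarith
  have h1 : |a * (‖z‖ ^ 2 - 1)| ≤ |a| * s := by
    rw [abs_mul]; gcongr; rw [abs_le]; constructor <;> nlinarith [sq_nonneg ‖z‖]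
  have h2 : |2 * (star z * w).re| ≤ 2 * (‖z‖ * ‖w‖) := by
    rw [abs_mul, abs_two]; gcongr
    refine (Complex.abs_re_le_norm _).trans ?_
    rw [norm_mul, norm_star]
  have h3 : |x| ≤ |a| * s + 2 * (‖z‖ * ‖w‖) := by rw [hx]; exact (abs_add_le _ _).trans (add_le_add h1 h2)
  have h4 : x ^ 2 ≤ 2 * a ^ 2 * s ^ 2 + 8 * s * ‖w‖ ^ 2 := by
    rw [← sq_abs (x)]
    calc |x| ^ 2 ≤ (|a| * s + 2 * (‖z‖ * ‖w‖)) ^ 2 := by gcongr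
      _ ≤ 2 * (|a| * s) ^ 2 + 2 * (2 * (‖z‖ * ‖w‖)) ^ 2 := by
          nlinarith [sq_nonneg (|a| * s - 2 * (‖z‖ * ‖w‖))]
      _ = 2 * a ^ 2 * s ^ 2 + 8 * ‖z‖ ^ 2 * ‖w‖ ^ 2 := by rw [mul_pow, sq_abs]; ring
      _ ≤ _ := by gcongr
  have h5 : |x| ≤ δ₀ * s / 2 + 4 / δ₀ * ‖w‖ ^ 2 := by
    have e1 : |a| * s ≤ δ₀ / 4 * s := by gcongr
    have e2 : 2 * (‖z‖ * ‖w‖) ≤ δ₀ / 4 * ‖z‖ ^ 2 + 4 / δ₀ * ‖w‖ ^ 2 := by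
      have := sq_nonneg (δ₀ / 2 * ‖z‖ - 2 * ‖w‖)
      have h : 0 ≤ (δ₀ / 2 * ‖z‖ - 2 * ‖w‖) ^ 2 / δ₀ := by positivity
      have e : (δ₀ / 2 * ‖z‖ - 2 * ‖w‖) ^ 2 / δ₀ = δ₀ / 4 * ‖z‖ ^ 2 + 4 / δ₀ * ‖w‖ ^ 2 - 2 * (‖z‖ * ‖w‖) := by
        field_simp; ring
      linarith
    nlinarith
  have h6 : Real.exp |x| ≤ Real.exp (δ₀ * s / 2) * Real.exp (4 / δ₀ * ‖w‖ ^ 2) := by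
    rw [← Real.exp_add]; exact Real.exp_le_exp.2 h5
  have q := Real.quadratic_le_exp_of_nonneg (x := δ₀ * s / 2) (by positivity)
  have h7 : s ^ 2 ≤ 8 / δ₀ ^ 2 * Real.exp (δ₀ * s / 2) := by
    have : (δ₀ * s / 2) ^ 2 / 2 ≤ Real.exp (δ₀ * s / 2) := by linarith [mul_pos hδ hs0]
    rw [div_mul_eq_mul_div, le_div_iff₀ (by positivity)]; linarith
  have h8 : s ≤ 2 / δ₀ * Real.exp (δ₀ * s / 2) := by
    have : (δ₀ * s / 2) ≤ Real.exp (δ₀ * s / 2) := by linarith [mul_pos hδ hs0, sq_nonneg (δ₀ * s / 2)]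
    rw [div_mul_eq_mul_div, le_div_iff₀ (by positivity)]; linarith
  set e := Real.exp (δ₀ * s / 2) with he
  have hee : e * e = Real.exp δ₀ * Real.exp (δ₀ * ‖z‖ ^ 2) := by
    rw [he, ← Real.exp_add, ← Real.exp_add]; congr 1; rw [hs]; ring
  calc x ^ 2 * Real.exp |x|
      ≤ (2 * a ^ 2 * (8 / δ₀ ^ 2 * e) + 8 * (2 / δ₀ * e) * ‖w‖ ^ 2) * (e * Real.exp (4 / δ₀ * ‖w‖ ^ 2)) := by
        refine mul_le_mul (h4.trans ?_) h6 (Real.exp_pos _).le (by positivity)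
        gcongr
    _ = (16 * (1 / δ₀ ^ 2) * a ^ 2 + 16 * (1 / δ₀) * ‖w‖ ^ 2) * Real.exp (4 / δ₀ * ‖w‖ ^ 2) * (e * e) := by ring
    _ ≤ (16 * (1 / δ₀ ^ 2 + 1 / δ₀) * a ^ 2 + 16 * (1 / δ₀ ^ 2 + 1 / δ₀) * ‖w‖ ^ 2) * Real.exp (4 / δ₀ * ‖w‖ ^ 2) * (e * e) := by
        have p1 : 0 < 1 / δ₀ := by positivity
        have p2 : 0 < 1 / δ₀ ^ 2 := by positivity
        gcongr <;> linarith
    _ = 16 * (1 / δ₀ ^ 2 + 1 / δ₀) * Real.exp δ₀ * (a ^ 2 + ‖w‖ ^ 2) * Real.exp (4 / δ₀ * ‖w‖ ^ 2) * Real.exp (δ₀ * ‖z‖ ^ 2) := by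
        rw [hee]; ring

lemma SG_of_moment (δ₀ D : ℝ) (hδ : 0 < δ₀) : ∃ C c0 : ℝ, 0 < C ∧ 0 < c0 ∧
    ∀ ν : Measure ℂ, IsProbabilityMeasure ν → (∫ z, z ∂ν) = 0 → (∫ z, ‖z‖ ^ 2 ∂ν) = 1 →
    (∫⁻ z, ENNReal.ofReal (Real.exp (δ₀ * ‖z‖ ^ 2)) ∂ν) ≤ ENNReal.ofReal D → SGc ν C c0 := by
  set D1 := max D 1 with hD1
  have hD1p : 1 ≤ D1 := le_max_right _ _
  set B := 16 * (1 / δ₀ ^ 2 + 1 / δ₀) * Real.exp δ₀ * D1 with hB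
  have hBp : 0 < B := by positivity
  refine ⟨B + 4 / δ₀, δ₀ / 4, by positivity, by positivity, ?_⟩
  intro ν hν hmean hvar hmom a w ha
  set g : ℂ → ℝ := fun z => Real.exp (δ₀ * ‖z‖ ^ 2) with hg
  have hgc : Continuous g := by fun_prop
  have hgi : Integrable g ν := by
    refine ⟨hgc.aestronglyMeasurable, ?_⟩
    rw [hasFiniteIntegral_iff_ofReal (Filter.Eventually.of_forall fun z => (Real.exp_pos _).le)]
    exact lt_of_le_of_lt hmom ENNReal.ofReal_lt_top
  have hgD : ∫ z, g z ∂ν ≤ D1 := by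
    rw [integral_eq_lintegral_of_nonneg_ae (Filter.Eventually.of_forall fun z => (Real.exp_pos _).le) hgc.aestronglyMeasurable]
    refine ENNReal.toReal_le_of_le_ofReal (by positivity) (hmom.trans ?_)
    exact ENNReal.ofReal_le_ofReal (le_max_left _ _)
  have hg1 : ∀ z, 1 ≤ g z := fun z => Real.one_le_exp (by positivity)
  -- integrability of z and |z|^2
  have hsq : ∀ z : ℂ, ‖z‖ ^ 2 ≤ (1 / δ₀) * g z := by
    intro z
    have := Real.add_one_le_exp (δ₀ * ‖z‖ ^ 2)
    have h2 : δ₀ * ‖z‖ ^ 2 ≤ g z := by simp only [hg]; linarith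
    rw [one_div, inv_mul_eq_div, le_div_iff₀ hδ]; linarith
  have hi2 : Integrable (fun z : ℂ => ‖z‖ ^ 2) ν := by
    refine (hgi.const_mul (1 / δ₀)).mono' (by fun_prop) (Filter.Eventually.of_forall fun z => ?_)
    rw [Real.norm_of_nonneg (by positivity)]; exact hsq z
  have hi1 : Integrable (fun z : ℂ => z) ν := by
    refine ((integrable_const (1 : ℝ)).add hi2).mono' (by fun_prop) (Filter.Eventually.of_forall fun z => ?_)
    simp only [Pi.add_apply]
    nlinarith [sq_nonneg (‖z‖ - 1), norm_nonneg z]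
  set x : ℂ → ℝ := fun z => a * (‖z‖ ^ 2 - 1) + 2 * (star z * w).re with hx
  have hxc : Continuous x := by simp only [hx]; fun_prop
  have hstar : ∀ z : ℂ, (star z * w).re = (z * star w).re := by
    intro z; simp [Complex.mul_re]
  have hiw : Integrable (fun z : ℂ => z * star w) ν := hi1.mul_const _
  have hxi : Integrable x ν := by
    simp only [hx, hstar]
    exact ((hi2.sub (integrable_const 1)).const_mul a).add (hiw.re.const_mul 2)
  have hx0 : ∫ z, x z ∂ν = 0 := by
    simp only [hx, hstar]
    have ee1 : ∫ z, (a * (‖z‖ ^ 2 - 1) + 2 * (z * star w).re) ∂ν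
        = (∫ z, a * (‖z‖ ^ 2 - 1) ∂ν) + ∫ z, 2 * (z * star w).re ∂ν :=
      integral_add ((hi2.sub (integrable_const 1)).const_mul a) (hiw.re.const_mul 2)
    rw [ee1, integral_const_mul, integral_const_mul, integral_sub hi2 (integrable_const 1), hvar]
    have : ∫ z : ℂ, (z * star w).re ∂ν = 0 := by
      have h1 := integral_re hiw
      simp only [RCLike.re_to_complex] at h1
      rw [h1, integral_mul_const, hmean]; simp
    rw [this]; simp
  set R := B / D1 * (a ^ 2 + ‖w‖ ^ 2) * Real.exp (4 / δ₀ * ‖w‖ ^ 2) with hR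
  have key : ∀ z, x z ^ 2 * Real.exp |x z| ≤ R * g z := by
    intro z
    refine (SG_key δ₀ a w z hδ ha _ rfl).trans (le_of_eq ?_)
    rw [hR, hB]; simp only [hg]; field_simp
  have hRi : Integrable (fun z => 1 + x z + R * g z) ν := ((integrable_const 1).add hxi).add (hgi.const_mul R)
  have hpt : ∀ z, Real.exp (x z) ≤ 1 + x z + R * g z := fun z => (exp_le_quad _).trans (by linarith [key z])
  have hR0 : 0 ≤ R := by positivity
  calc ∫⁻ z, ENNReal.ofReal (Real.exp (x z)) ∂ν
      ≤ ∫⁻ z, ENNReal.ofReal (1 + x z + R * g z) ∂ν := lintegral_mono fun z => ENNReal.ofReal_le_ofReal (hpt z)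
    _ = ENNReal.ofReal (∫ z, (1 + x z + R * g z) ∂ν) :=
        (ofReal_integral_eq_lintegral_ofReal hRi (Filter.Eventually.of_forall fun z => (Real.exp_pos _).le.trans (hpt z))).symm
    _ ≤ _ := by
      apply ENNReal.ofReal_le_ofReal
      have e1 : ∫ z, (1 + x z + R * g z) ∂ν = 1 + R * ∫ z, g z ∂ν := by
        have ee1 : ∫ z, (1 + x z + R * g z) ∂ν = (∫ z, (1 + x z) ∂ν) + ∫ z, R * g z ∂ν :=
          integral_add ((integrable_const 1).add hxi) (hgi.const_mul R)
        rw [ee1, integral_add (integrable_const 1) hxi, hx0, integral_const_mul]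
        simp
      rw [e1]
      have e2 : R * ∫ z, g z ∂ν ≤ R * D1 := by gcongr
      have e3 : R * D1 = B * (a ^ 2 + ‖w‖ ^ 2) * Real.exp (4 / δ₀ * ‖w‖ ^ 2) := by
        rw [hR]; field_simp
      have e4 := Real.add_one_le_exp (B * (a ^ 2 + ‖w‖ ^ 2))
      have e5 : 1 ≤ Real.exp (4 / δ₀ * ‖w‖ ^ 2) := Real.one_le_exp (by positivity)
      have e6 : 0 ≤ B * (a ^ 2 + ‖w‖ ^ 2) := by positivity
      calc 1 + R * ∫ z, g z ∂ν ≤ 1 + B * (a ^ 2 + ‖w‖ ^ 2) * Real.exp (4 / δ₀ * ‖w‖ ^ 2) := by linarith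
        _ ≤ (1 + B * (a ^ 2 + ‖w‖ ^ 2)) * Real.exp (4 / δ₀ * ‖w‖ ^ 2) := by nlinarith
        _ ≤ Real.exp (B * (a ^ 2 + ‖w‖ ^ 2)) * Real.exp (4 / δ₀ * ‖w‖ ^ 2) := by gcongr; linarith
        _ ≤ _ := by
          rw [← Real.exp_add]; apply Real.exp_le_exp.2
          have : 0 ≤ 4 / δ₀ * a ^ 2 := by positivity
          nlinarith
end

open MeasureTheory ProbabilityTheory
open scoped ENNReal NNReal
noncomputable section

/-- real part of the quadratic form -/
def qf {n : ℕ} (M : Matrix (Fin n) (Fin n) ℂ) (v : Fin n → ℂ) : ℝ :=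
  ∑ k, ∑ l, (star (v k) * M k l * v l).re

def nsq {n : ℕ} (v : Fin n → ℂ) : ℝ := ∑ k, ‖v k‖ ^ 2

def hs2 {n : ℕ} (M : Matrix (Fin n) (Fin n) ℂ) : ℝ := ∑ k, ∑ l, ‖M k l‖ ^ 2

def trr {n : ℕ} (M : Matrix (Fin n) (Fin n) ℂ) : ℝ := ∑ k, (M k k).re

/-- linear form of the first row -/
def rowf {n : ℕ} (M : Matrix (Fin (n+1)) (Fin (n+1)) ℂ) (v : Fin n → ℂ) : ℂ :=
  ∑ l : Fin n, M 0 l.succ * v l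

lemma nsq_nonneg {n : ℕ} (v : Fin n → ℂ) : 0 ≤ nsq v := Finset.sum_nonneg fun _ _ => by positivity

lemma qf_cons {n : ℕ} (M : Matrix (Fin (n+1)) (Fin (n+1)) ℂ) (hM : M.IsHermitian) (t : ℂ) (v : Fin n → ℂ) :
    qf M (Fin.cons t v) = (M 0 0).re * ‖t‖ ^ 2 + 2 * (star t * rowf M v).re
      + qf (M.submatrix Fin.succ Fin.succ) v := by
  unfold qf rowf
  simp only [Fin.sum_univ_succ, Fin.cons_zero, Fin.cons_succ, Finset.sum_add_distrib, Matrix.submatrix_apply]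
  have e1 : (star t * M 0 0 * t).re = (M 0 0).re * ‖t‖ ^ 2 := by
    have : star t * M 0 0 * t = M 0 0 * ((‖t‖ ^ 2 : ℝ) : ℂ) := by
      rw [← Complex.normSq_eq_norm_sq, Complex.normSq_eq_conj_mul_self]; simp; ring
    rw [this, Complex.re_mul_ofReal]
  have e2 : ∑ x : Fin n, (star t * M 0 x.succ * v x).re = (star t * ∑ l : Fin n, M 0 l.succ * v l).re := by
    rw [Finset.mul_sum, Complex.re_sum]; simp only [mul_assoc]
  have e3 : ∑ x : Fin n, (star (v x) * M x.succ 0 * t).re = (star t * ∑ l : Fin n, M 0 l.succ * v l).re := by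
    rw [← e2]; refine Finset.sum_congr rfl fun x _ => ?_
    rw [← hM.apply x.succ 0]
    simp [Complex.mul_re, Complex.mul_im]; ring
  rw [e1, e2, e3]; ring

lemma nsq_cons {n : ℕ} (t : ℂ) (v : Fin n → ℂ) : nsq (Fin.cons t v : Fin (n+1) → ℂ) = ‖t‖ ^ 2 + nsq v := by
  simp [nsq, Fin.sum_univ_succ]

/-- the updated matrix -/
def upd {n : ℕ} (M : Matrix (Fin (n+1)) (Fin (n+1)) ℂ) (C : ℝ) : Matrix (Fin n) (Fin n) ℂ :=
  Matrix.of fun k l => M k.succ l.succ + (C : ℂ) * (star (M 0 k.succ) * M 0 l.succ)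

lemma upd_herm {n : ℕ} (M : Matrix (Fin (n+1)) (Fin (n+1)) ℂ) (hM : M.IsHermitian) (C : ℝ) : (upd M C).IsHermitian := by
  ext k l
  simp only [upd, Matrix.conjTranspose_apply, Matrix.of_apply]
  rw [← hM.apply k.succ l.succ]
  simp [mul_comm]

lemma qf_upd {n : ℕ} (M : Matrix (Fin (n+1)) (Fin (n+1)) ℂ) (C : ℝ) (v : Fin n → ℂ) :
    qf (upd M C) v = qf (M.submatrix Fin.succ Fin.succ) v + C * ‖rowf M v‖ ^ 2 := by
  have e : ((‖rowf M v‖ ^ 2 : ℝ) : ℂ) = ∑ k : Fin n, ∑ l : Fin n, star (v k) * (star (M 0 k.succ) * M 0 l.succ) * v l := by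
    rw [← Complex.normSq_eq_norm_sq, Complex.normSq_eq_conj_mul_self, rowf, map_sum, Finset.sum_mul_sum]
    refine Finset.sum_congr rfl fun k _ => Finset.sum_congr rfl fun l _ => ?_
    simp; ring
  have e' := congrArg Complex.re e
  rw [Complex.ofReal_re] at e'
  rw [e']; simp only [Complex.re_sum, Finset.mul_sum]
  simp only [qf, ← Finset.sum_add_distrib]
  refine Finset.sum_congr rfl fun k _ => Finset.sum_congr rfl fun l _ => ?_
  rw [← Complex.re_ofReal_mul, ← Complex.add_re]; congr 1
  simp only [upd, Matrix.of_apply, Matrix.submatrix_apply]; ring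

lemma trr_upd {n : ℕ} (M : Matrix (Fin (n+1)) (Fin (n+1)) ℂ) (C : ℝ) :
    trr (upd M C) = trr (M.submatrix Fin.succ Fin.succ) + C * nsq (fun l : Fin n => M 0 l.succ) := by
  simp only [trr, nsq, Finset.mul_sum, ← Finset.sum_add_distrib]
  refine Finset.sum_congr rfl fun k _ => ?_
  simp only [upd, Matrix.of_apply, Matrix.submatrix_apply, Complex.add_re, Complex.re_ofReal_mul]
  rw [← Complex.normSq_eq_norm_sq]; simp [Complex.normSq_apply, Complex.mul_re]

lemma hs2_upd {n : ℕ} (M : Matrix (Fin (n+1)) (Fin (n+1)) ℂ) (hM : M.IsHermitian) (C : ℝ) :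
    hs2 (upd M C) = hs2 (M.submatrix Fin.succ Fin.succ)
      + 2 * C * qf (M.submatrix Fin.succ Fin.succ) (fun l : Fin n => star (M 0 l.succ))
      + C ^ 2 * nsq (fun l : Fin n => M 0 l.succ) ^ 2 := by
  have e1 : nsq (fun l : Fin n => M 0 l.succ) ^ 2 = ∑ k : Fin n, ∑ l : Fin n, ‖M 0 k.succ‖ ^ 2 * ‖M 0 l.succ‖ ^ 2 := by
    rw [sq, nsq, Finset.sum_mul_sum]
  rw [e1]
  simp only [hs2, qf, Finset.mul_sum, ← Finset.sum_add_distrib]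
  rw [Finset.sum_comm]
  refine Finset.sum_congr rfl fun k _ => Finset.sum_congr rfl fun l _ => ?_
  simp only [upd, Matrix.of_apply, Matrix.submatrix_apply]
  rw [← hM.apply k.succ l.succ]
  simp only [← Complex.normSq_eq_norm_sq, Complex.normSq_apply]
  simp [Complex.mul_re, Complex.mul_im]; ring

lemma hs2_succ {n : ℕ} (M : Matrix (Fin (n+1)) (Fin (n+1)) ℂ) (hM : M.IsHermitian) :
    hs2 M = hs2 (M.submatrix Fin.succ Fin.succ) + 2 * nsq (fun l : Fin n => M 0 l.succ) + ‖M 0 0‖ ^ 2 := by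
  simp only [hs2, nsq, Fin.sum_univ_succ, Finset.sum_add_distrib, Matrix.submatrix_apply]
  have : ∑ x : Fin n, ‖M x.succ 0‖ ^ 2 = ∑ x : Fin n, ‖M 0 x.succ‖ ^ 2 := by
    refine Finset.sum_congr rfl fun x _ => ?_
    rw [← hM.apply x.succ 0, norm_star]
  rw [this]; ring

lemma trr_succ {n : ℕ} (M : Matrix (Fin (n+1)) (Fin (n+1)) ℂ) :
    trr M = (M 0 0).re + trr (M.submatrix Fin.succ Fin.succ) := by
  simp [trr, Fin.sum_univ_succ]

lemma rowf_self {n : ℕ} (M : Matrix (Fin (n+1)) (Fin (n+1)) ℂ) :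
    rowf M (fun l : Fin n => star (M 0 l.succ)) = (nsq (fun l : Fin n => M 0 l.succ) : ℂ) := by
  simp only [rowf, nsq, Complex.ofReal_sum]
  refine Finset.sum_congr rfl fun k _ => ?_
  rw [← Complex.normSq_eq_norm_sq, ← Complex.mul_conj]; rfl

lemma hw_step {n : ℕ} (M : Matrix (Fin (n+1)) (Fin (n+1)) ℂ) (hM : M.IsHermitian) (C lam : ℝ) (hC : 0 < C)
    (hl : 0 < lam) (hlC : 2 * C * lam ≤ 1) (hb : ∀ v, |qf M v| ≤ lam * nsq v) :
    |(M 0 0).re| ≤ lam ∧ (∀ v, |qf (upd M C) v| ≤ lam * nsq v) ∧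
    C * (M 0 0).re ^ 2 + C * nsq (fun l : Fin n => M 0 l.succ) + 2 * C * hs2 (upd M C) ≤ 2 * C * hs2 M := by
  have h00 : |(M 0 0).re| ≤ lam := by
    have := hb (Fin.cons 1 0)
    rw [qf_cons M hM, nsq_cons] at this
    simpa [qf, rowf, nsq] using this
  have hsub : ∀ v, |qf (M.submatrix Fin.succ Fin.succ) v| ≤ lam * nsq v := by
    intro v
    have := hb (Fin.cons 0 v)
    rw [qf_cons M hM, nsq_cons] at this
    simpa using this
  refine ⟨h00, ?_, ?_⟩
  · intro v
    rw [qf_upd]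
    have h1 := abs_le.1 (hsub v)
    have hp : 0 ≤ C * ‖rowf M v‖ ^ 2 := by positivity
    rw [abs_le]; refine ⟨by linarith, ?_⟩
    have h2 := (abs_le.1 (hb (Fin.cons ((C : ℂ) * rowf M v) v))).2
    rw [qf_cons M hM, nsq_cons] at h2
    have e1 : ‖(C : ℂ) * rowf M v‖ ^ 2 = C ^ 2 * ‖rowf M v‖ ^ 2 := by
      rw [norm_mul, Complex.norm_real, mul_pow, Real.norm_eq_abs, sq_abs]
    have e2 : (star ((C : ℂ) * rowf M v) * rowf M v).re = C * ‖rowf M v‖ ^ 2 := by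
      rw [← Complex.normSq_eq_norm_sq]; simp [Complex.normSq_apply, Complex.mul_re]; ring
    rw [e1, e2] at h2
    have h3 := (abs_le.1 h00).1
    have h4 : (lam - (M 0 0).re) * (C ^ 2 * ‖rowf M v‖ ^ 2) ≤ C * ‖rowf M v‖ ^ 2 := by
      have : (lam - (M 0 0).re) * C ≤ 1 := by nlinarith
      calc (lam - (M 0 0).re) * (C ^ 2 * ‖rowf M v‖ ^ 2) = ((lam - (M 0 0).re) * C) * (C * ‖rowf M v‖ ^ 2) := by ring
        _ ≤ 1 * (C * ‖rowf M v‖ ^ 2) := by gcongr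
        _ = _ := one_mul _
    nlinarith
  · rw [hs2_upd M hM, hs2_succ M hM]
    set r := nsq (fun l : Fin n => M 0 l.succ) with hr
    have hr0 : 0 ≤ r := nsq_nonneg _
    have hnr : nsq (fun l : Fin n => star (M 0 l.succ)) = r := by simp [hr, nsq]
    have h1 := (abs_le.1 (hsub (fun l : Fin n => star (M 0 l.succ)))).2
    rw [hnr] at h1
    have h2 : r ≤ lam ^ 2 := by
      have a1 := (abs_le.1 (hb (Fin.cons ((Real.sqrt r : ℝ) : ℂ) (fun l : Fin n => star (M 0 l.succ))))).2
      have a2 := (abs_le.1 (hb (Fin.cons (-(Real.sqrt r : ℝ) : ℂ) (fun l : Fin n => star (M 0 l.succ))))).1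
      rw [qf_cons M hM, nsq_cons, rowf_self, ← hr, hnr] at a1 a2
      rw [norm_neg] at a2
      have e1 : ‖((Real.sqrt r : ℝ) : ℂ)‖ ^ 2 = r := by
        rw [Complex.norm_real, Real.norm_eq_abs, sq_abs, Real.sq_sqrt hr0]
      have e2 : (star ((Real.sqrt r : ℝ) : ℂ) * (r : ℂ)).re = Real.sqrt r * r := by simp
      have e3 : (star (-((Real.sqrt r : ℝ) : ℂ)) * (r : ℂ)).re = -(Real.sqrt r * r) := by simp
      rw [e1, e2] at a1
      rw [e1, e3] at a2
      have a3 : Real.sqrt r * r ≤ lam * r := by linarith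
      by_cases h0 : r = 0
      · rw [h0]; positivity
      have hrp : 0 < r := lt_of_le_of_ne hr0 (Ne.symm h0)
      have a4 : Real.sqrt r ≤ lam := le_of_mul_le_mul_right a3 hrp
      calc r = Real.sqrt r ^ 2 := (Real.sq_sqrt hr0).symm
        _ ≤ _ := by gcongr
    have h3 : C ^ 2 * r ^ 2 ≤ r / 4 := by
      calc C ^ 2 * r ^ 2 = (C ^ 2 * r) * r := by ring
        _ ≤ (C ^ 2 * lam ^ 2) * r := by gcongr
        _ ≤ (1 / 4) * r := by gcongr; nlinarith [mul_pos hC hl]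
        _ = _ := by ring
    have h4 : 2 * C * qf (M.submatrix Fin.succ Fin.succ) (fun l : Fin n => star (M 0 l.succ)) ≤ r := by
      calc _ ≤ 2 * C * (lam * r) := by gcongr
        _ = (2 * C * lam) * r := by ring
        _ ≤ 1 * r := by gcongr
        _ = r := one_mul r
    have h5 : (M 0 0).re ^ 2 ≤ ‖M 0 0‖ ^ 2 := by
      rw [← sq_abs]; gcongr; exact Complex.abs_re_le_norm _
    have h6 : (M 0 0).re ^ 2 + r + 2 * (hs2 (M.submatrix Fin.succ Fin.succ)
      + 2 * C * qf (M.submatrix Fin.succ Fin.succ) (fun l : Fin n => star (M 0 l.succ)) + C ^ 2 * r ^ 2)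
      ≤ 2 * (hs2 (M.submatrix Fin.succ Fin.succ) + 2 * r + ‖M 0 0‖ ^ 2) := by nlinarith
    nlinarith

lemma measurable_qf {n : ℕ} (M : Matrix (Fin n) (Fin n) ℂ) : Measurable (qf M) := by
  unfold qf; fun_prop

lemma hw_mgf (C lam : ℝ) (hC : 0 < C) (hl : 0 < lam) (hlC : 2 * C * lam ≤ 1) :
    ∀ (n : ℕ) (ν : Fin n → Measure ℂ) (_ : ∀ k, IsProbabilityMeasure (ν k)) (_ : ∀ k, SGc (ν k) C lam)
      (M : Matrix (Fin n) (Fin n) ℂ) (_ : M.IsHermitian) (_ : ∀ v, |qf M v| ≤ lam * nsq v),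
      ∫⁻ v, ENNReal.ofReal (Real.exp (qf M v - trr M)) ∂(Measure.pi ν)
        ≤ ENNReal.ofReal (Real.exp (2 * C * hs2 M)) := by
  intro n
  induction n with
  | zero =>
    intro ν hp hν M hM hb
    simp [qf, trr, hs2]
  | succ n ih =>
    intro ν hp hν M hM hb
    obtain ⟨h00, hub, hhs⟩ := hw_step M hM C lam hC hl hlC hb
    have mp := (measurePreserving_piFinSuccAbove ν 0).symm
    rw [← mp.lintegral_comp_emb (MeasurableEquiv.measurableEmbedding _)]
    have e : ∀ p : ℂ × (Fin n → ℂ), (MeasurableEquiv.piFinSuccAbove (fun _ => ℂ) 0).symm p = (Fin.cons p.1 p.2 : Fin (n+1) → ℂ) := by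
      intro p; simp [MeasurableEquiv.piFinSuccAbove_symm_apply, Fin.insertNthEquiv]
    simp only [e]
    have hmeas : Measurable (fun p : ℂ × (Fin n → ℂ) => ENNReal.ofReal (Real.exp (qf M (Fin.cons p.1 p.2) - trr M))) := by
      simp only [qf_cons M hM]
      unfold qf rowf; fun_prop
    rw [lintegral_prod_symm _ hmeas.aemeasurable]
    simp only [Fin.zero_succAbove]
    set r := nsq (fun l : Fin n => M 0 l.succ) with hr
    calc ∫⁻ v, ∫⁻ t, ENNReal.ofReal (Real.exp (qf M (Fin.cons t v) - trr M)) ∂(ν 0) ∂(Measure.pi fun j => ν j.succ)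
        ≤ ∫⁻ v, ENNReal.ofReal (Real.exp (C * (M 0 0).re ^ 2 + C * r)) * ENNReal.ofReal (Real.exp (qf (upd M C) v - trr (upd M C))) ∂(Measure.pi fun j => ν j.succ) := by
          refine lintegral_mono fun v => ?_
          have e1 : ∀ t : ℂ, ENNReal.ofReal (Real.exp (qf M (Fin.cons t v) - trr M)) =
              ENNReal.ofReal (Real.exp (qf (M.submatrix Fin.succ Fin.succ) v - trr (M.submatrix Fin.succ Fin.succ))) *
              ENNReal.ofReal (Real.exp ((M 0 0).re * (‖t‖ ^ 2 - 1) + 2 * (star t * rowf M v).re)) := by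
            intro t
            rw [← ENNReal.ofReal_mul (Real.exp_pos _).le, ← Real.exp_add, qf_cons M hM, trr_succ]
            congr 2; ring
          simp only [e1]
          rw [lintegral_const_mul _ (by fun_prop)]
          refine (mul_le_mul_right (hν 0 (M 0 0).re (rowf M v) h00) _).trans (le_of_eq ?_)
          rw [← ENNReal.ofReal_mul (Real.exp_pos _).le, ← Real.exp_add, ← ENNReal.ofReal_mul (Real.exp_pos _).le, ← Real.exp_add, qf_upd, trr_upd]
          congr 2; ring
      _ = ENNReal.ofReal (Real.exp (C * (M 0 0).re ^ 2 + C * r)) * ∫⁻ v, ENNReal.ofReal (Real.exp (qf (upd M C) v - trr (upd M C))) ∂(Measure.pi fun j => ν j.succ) := by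
          rw [lintegral_const_mul]
          have := measurable_qf (upd M C); fun_prop
      _ ≤ ENNReal.ofReal (Real.exp (C * (M 0 0).re ^ 2 + C * r)) * ENNReal.ofReal (Real.exp (2 * C * hs2 (upd M C))) := by
          gcongr
          exact ih _ (fun k => hp _) (fun k => hν _) _ (upd_herm M hM C) hub
      _ ≤ _ := by
          rw [← ENNReal.ofReal_mul (Real.exp_pos _).le, ← Real.exp_add]
          exact ENNReal.ofReal_le_ofReal (Real.exp_le_exp.2 hhs)

/-- tail bound -/
lemma hw_tail (C lam : ℝ) (hC : 0 < C) (hl : 0 < lam) (hlC : 2 * C * lam ≤ 1)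
    {n : ℕ} (ν : Fin n → Measure ℂ) (hp : ∀ k, IsProbabilityMeasure (ν k)) (hν : ∀ k, SGc (ν k) C lam)
      (M : Matrix (Fin n) (Fin n) ℂ) (hM : M.IsHermitian) (hb : ∀ v, |qf M v| ≤ lam * nsq v) (t : ℝ) :
      Measure.pi ν {v | t ≤ qf M v - trr M} ≤ ENNReal.ofReal (Real.exp (2 * C * hs2 M - t)) := by
  have h := hw_mgf C lam hC hl hlC n ν hp hν M hM hb
  have hm : Measurable (fun v => ENNReal.ofReal (Real.exp (qf M v - trr M))) := by
    have := measurable_qf M; fun_prop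
  have h2 := mul_meas_ge_le_lintegral (μ := Measure.pi ν) hm (ENNReal.ofReal (Real.exp t))
  have h3 : {v | t ≤ qf M v - trr M} ⊆ {v | ENNReal.ofReal (Real.exp t) ≤ ENNReal.ofReal (Real.exp (qf M v - trr M))} := by
    intro v hv
    exact ENNReal.ofReal_le_ofReal (Real.exp_le_exp.2 hv)
  have h4 := (mul_le_mul_right (measure_mono (μ := Measure.pi ν) h3) (ENNReal.ofReal (Real.exp t))).trans (h2.trans h)
  rw [Real.exp_sub, ENNReal.ofReal_div_of_pos (Real.exp_pos _), ENNReal.le_div_iff_mul_le]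
  · rwa [mul_comm]
  · left; simp [Real.exp_pos]
  · left; exact ENNReal.ofReal_ne_top
end

open MeasureTheory ProbabilityTheory
open scoped ENNReal NNReal
noncomputable section
open Matrix

/-- resolvent -/
def Rz {n : ℕ} (B : Matrix (Fin n) (Fin n) ℂ) (z : ℂ) : Matrix (Fin n) (Fin n) ℂ :=
  (B - z • (1 : Matrix (Fin n) (Fin n) ℂ))⁻¹

lemma star_dot_self {n : ℕ} (v : Fin n → ℂ) : star v ⬝ᵥ v = (nsq v : ℂ) := by
  simp only [dotProduct, nsq, Complex.ofReal_sum, Pi.star_apply]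
  refine Finset.sum_congr rfl fun k _ => ?_
  rw [← Complex.normSq_eq_norm_sq, Complex.normSq_eq_conj_mul_self]; rfl

lemma nsq_eq_zero {n : ℕ} {v : Fin n → ℂ} (h : nsq v = 0) : v = 0 := by
  funext k
  have := (Finset.sum_eq_zero_iff_of_nonneg (fun k _ => by positivity)).1 h k (Finset.mem_univ k)
  simpa using this

lemma cs_dot {n : ℕ} (v w : Fin n → ℂ) : ‖star v ⬝ᵥ w‖ ^ 2 ≤ nsq v * nsq w := by
  have h1 : ‖star v ⬝ᵥ w‖ ≤ ∑ k, ‖v k‖ * ‖w k‖ := by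
    refine (norm_sum_le _ _).trans (le_of_eq ?_)
    simp
  calc ‖star v ⬝ᵥ w‖ ^ 2 ≤ (∑ k, ‖v k‖ * ‖w k‖) ^ 2 := by gcongr
    _ ≤ _ := Finset.sum_mul_sq_le_sq_mul_sq _ _ _

lemma herm_im {n : ℕ} {B : Matrix (Fin n) (Fin n) ℂ} (hB : B.IsHermitian) (y : Fin n → ℂ) :
    (star y ⬝ᵥ B *ᵥ y).im = 0 := by
  have := hB.im_star_dotProduct_mulVec_self y
  simpa using this

lemma im_form {n : ℕ} {B : Matrix (Fin n) (Fin n) ℂ} (hB : B.IsHermitian) (z : ℂ) (y : Fin n → ℂ) :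
    (star y ⬝ᵥ (B - z • (1 : Matrix (Fin n) (Fin n) ℂ)) *ᵥ y).im = - z.im * nsq y := by
  rw [sub_mulVec, dotProduct_sub, Complex.sub_im, herm_im hB, smul_mulVec, one_mulVec, dotProduct_smul,
    star_dot_self]
  simp

lemma det_ne {n : ℕ} {B : Matrix (Fin n) (Fin n) ℂ} (hB : B.IsHermitian) (z : ℂ) (hz : z.im ≠ 0) :
    IsUnit (B - z • (1 : Matrix (Fin n) (Fin n) ℂ)).det := by
  rw [isUnit_iff_ne_zero]
  intro h
  obtain ⟨v, hv, h0⟩ := Matrix.exists_mulVec_eq_zero_iff.2 h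
  have := im_form hB z v
  rw [h0] at this
  simp [hz] at this
  exact hv (nsq_eq_zero this)

lemma Rz_conj {n : ℕ} {B : Matrix (Fin n) (Fin n) ℂ} (hB : B.IsHermitian) (z : ℂ) :
    (Rz B z)ᴴ = Rz B (star z) := by
  unfold Rz
  rw [conjTranspose_nonsing_inv, conjTranspose_sub, conjTranspose_smul, hB.eq, conjTranspose_one]

lemma im_Rz' {n : ℕ} {B : Matrix (Fin n) (Fin n) ℂ} (hB : B.IsHermitian) (z : ℂ) (hz : z.im ≠ 0) (v : Fin n → ℂ) :
    (star v ⬝ᵥ Rz B z *ᵥ v).im = z.im * nsq ((Rz B z)ᴴ *ᵥ v) := by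
  set y := (Rz B z)ᴴ *ᵥ v with hy
  have hv : v = (B - star z • (1 : Matrix (Fin n) (Fin n) ℂ)) *ᵥ y := by
    rw [hy, Rz_conj hB, mulVec_mulVec, Rz, Matrix.mul_nonsing_inv _ (det_ne hB _ (by simpa using hz)), one_mulVec]
  have e : star v ⬝ᵥ Rz B z *ᵥ v = star y ⬝ᵥ v := by
    rw [hy, star_mulVec, conjTranspose_conjTranspose, dotProduct_mulVec]
  rw [e]
  conv_lhs => rw [hv]
  rw [im_form hB]; simp

lemma im_Rz {n : ℕ} {B : Matrix (Fin n) (Fin n) ℂ} (hB : B.IsHermitian) (z : ℂ) (hz : z.im ≠ 0) (v : Fin n → ℂ) :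
    (star v ⬝ᵥ Rz B z *ᵥ v).im = z.im * nsq ((Rz B z) *ᵥ v) := by
  have h := im_Rz' hB (star z) (by simpa using hz) v
  rw [Rz_conj hB, star_star] at h
  have e : star v ⬝ᵥ Rz B z *ᵥ v = star (star v ⬝ᵥ Rz B (star z) *ᵥ v) := by
    rw [star_dotProduct, star_mulVec, ← Rz_conj hB, dotProduct_mulVec]
  rw [e]
  simp at h ⊢
  linarith

lemma nsq_Rz_le {n : ℕ} {B : Matrix (Fin n) (Fin n) ℂ} (hB : B.IsHermitian) (z : ℂ) (hz : 0 < z.im) (v : Fin n → ℂ) :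
    ‖star v ⬝ᵥ Rz B z *ᵥ v‖ ≤ nsq v / z.im := by
  have h1 := im_Rz hB z hz.ne' v
  have h2 := cs_dot v (Rz B z *ᵥ v)
  have h3 := Complex.abs_im_le_norm (star v ⬝ᵥ Rz B z *ᵥ v)
  set A := ‖star v ⬝ᵥ Rz B z *ᵥ v‖
  set y := nsq (Rz B z *ᵥ v)
  have hy : 0 ≤ y := nsq_nonneg _
  have hv : 0 ≤ nsq v := nsq_nonneg _
  have h4 : z.im * y ≤ A := by rw [← h1]; exact (le_abs_self _).trans h3
  rw [le_div_iff₀ hz]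
  have hA : 0 ≤ A := norm_nonneg _
  rcases hA.eq_or_lt with h | h
  · rw [← h]; simpa using hv
  · have : A * (A * z.im) ≤ A * nsq v := by
      calc A * (A * z.im) = A ^ 2 * z.im := by ring
        _ ≤ nsq v * y * z.im := by gcongr
        _ = nsq v * (z.im * y) := by ring
        _ ≤ nsq v * A := by gcongr
        _ = _ := by ring
    exact le_of_mul_le_mul_left this h

lemma hs2_Rz {n : ℕ} {B : Matrix (Fin n) (Fin n) ℂ} (hB : B.IsHermitian) (z : ℂ) (hz : 0 < z.im) :
    (Rz B z).trace.im = z.im * hs2 (Rz B z) := by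
  unfold hs2
  rw [Finset.sum_comm, Finset.mul_sum, trace, Complex.im_sum]
  refine Finset.sum_congr rfl fun k _ => ?_
  have h := im_Rz hB z hz.ne' (Pi.single k 1)
  have e : Rz B z *ᵥ Pi.single k 1 = fun l => Rz B z l k := by
    rw [mulVec_single_one]; rfl
  rw [e] at h
  simpa [nsq] using h

lemma trace_Rz {n : ℕ} {B : Matrix (Fin n) (Fin n) ℂ} (hB : B.IsHermitian) (z : ℂ) (hz : z.im ≠ 0) :
    (Rz B z).trace = ∑ j, 1 / ((hB.eigenvalues j : ℂ) - z) := by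
  have hsp := hB.spectral_theorem
  set U : Matrix (Fin n) (Fin n) ℂ := (hB.eigenvectorUnitary : Matrix (Fin n) (Fin n) ℂ) with hU
  have hUU : U * star U = 1 := Unitary.mul_star_self_of_mem hB.eigenvectorUnitary.2
  have hUU' : star U * U = 1 := Unitary.star_mul_self_of_mem hB.eigenvectorUnitary.2
  have hne : ∀ j, (hB.eigenvalues j : ℂ) - z ≠ 0 := by
    intro j h
    have := congrArg Complex.im h
    simp at this; exact hz this
  have hB' : B = U * diagonal (fun j => (hB.eigenvalues j : ℂ)) * star U := by
    exact hsp
  have e : Rz B z = U * diagonal (fun j => 1 / ((hB.eigenvalues j : ℂ) - z)) * star U := by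
    unfold Rz
    apply Matrix.inv_eq_right_inv
    have e1 : B - z • (1 : Matrix (Fin n) (Fin n) ℂ) = U * diagonal (fun j => (hB.eigenvalues j : ℂ) - z) * star U := by
      have : diagonal (fun j => (hB.eigenvalues j : ℂ) - z) = diagonal (fun j => (hB.eigenvalues j : ℂ)) - z • (1 : Matrix (Fin n) (Fin n) ℂ) := by
        rw [smul_one_eq_diagonal, diagonal_sub]
      rw [this, mul_sub, sub_mul, ← hB']
      simp [hUU]
    rw [e1]
    calc _ = U * diagonal (fun j => (hB.eigenvalues j : ℂ) - z) * (star U * U) * diagonal (fun j => 1 / ((hB.eigenvalues j : ℂ) - z)) * star U := by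
          simp only [mul_assoc]
      _ = U * (diagonal (fun j => (hB.eigenvalues j : ℂ) - z) * diagonal (fun j => 1 / ((hB.eigenvalues j : ℂ) - z))) * star U := by
          rw [hUU']; simp only [mul_assoc, mul_one, one_mul]
      _ = 1 := by
          rw [diagonal_mul_diagonal]
          have : (fun j => ((hB.eigenvalues j : ℂ) - z) * (1 / ((hB.eigenvalues j : ℂ) - z))) = fun _ => 1 := by
            funext j; field_simp [hne j]
          rw [this, diagonal_one, mul_one, hUU]
  rw [e, trace_mul_comm, ← mul_assoc, hUU', one_mul, trace_diagonal]

lemma im_trace_Rz {n : ℕ} {B : Matrix (Fin n) (Fin n) ℂ} (hB : B.IsHermitian) (E η : ℝ) (hη : 0 < η) :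
    (Rz B (⟨E, η⟩ : ℂ)).trace.im = ∑ j, η / ((hB.eigenvalues j - E) ^ 2 + η ^ 2) := by
  rw [trace_Rz hB _ (by simpa using hη.ne'), Complex.im_sum]
  refine Finset.sum_congr rfl fun j _ => ?_
  rw [one_div, Complex.inv_im, Complex.normSq_apply]
  simp [← sq]

lemma schur {n : ℕ} {H : Matrix (Fin (n+1)) (Fin (n+1)) ℂ} (hH : H.IsHermitian) (i : Fin (n+1)) (z : ℂ) (hz : 0 < z.im) :
    Rz H z i i * (H i i - z - star (fun k => H (i.succAbove k) i) ⬝ᵥ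
      Rz (H.submatrix i.succAbove i.succAbove) z *ᵥ (fun k => H (i.succAbove k) i)) = 1 ∧
    ‖(Rz H z).trace - (Rz (H.submatrix i.succAbove i.succAbove) z).trace‖ ≤ 1 / z.im := by
  set B := H.submatrix i.succAbove i.succAbove with hBd
  set a : Fin n → ℂ := fun k => H (i.succAbove k) i with ha
  set G := Rz H z with hG
  set R := Rz B z with hR
  have hB : B.IsHermitian := hH.submatrix _
  have hGi : (H - z • (1 : Matrix _ _ ℂ)) * G = 1 := Matrix.mul_nonsing_inv _ (det_ne hH z hz.ne')
  have hRi : R * (B - z • (1 : Matrix _ _ ℂ)) = 1 := Matrix.nonsing_inv_mul _ (det_ne hB z hz.ne')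
  -- row i
  have row_i : ∀ q, (H i i - z) * G i q + star a ⬝ᵥ (fun k => G (i.succAbove k) q) = (1 : Matrix (Fin (n+1)) (Fin (n+1)) ℂ) i q := by
    intro q
    rw [← hGi, Matrix.mul_apply, Fin.sum_univ_succAbove _ i]
    congr 1
    · simp
    · simp only [dotProduct]
      refine Finset.sum_congr rfl fun k _ => ?_
      simp only [ha, Pi.star_apply, Matrix.sub_apply, Matrix.smul_apply]
      rw [hH.apply, one_apply_ne (Fin.succAbove_ne i k).symm]; simp
  have row_k : ∀ q, (fun k => G (i.succAbove k) q) = R *ᵥ (fun k => (1 : Matrix (Fin (n+1)) (Fin (n+1)) ℂ) (i.succAbove k) q) - G i q • (R *ᵥ a) := by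
    intro q
    have e1 : (B - z • (1 : Matrix _ _ ℂ)) *ᵥ (fun k => G (i.succAbove k) q) = (fun k => (1 : Matrix (Fin (n+1)) (Fin (n+1)) ℂ) (i.succAbove k) q) - G i q • a := by
      funext k
      rw [← hGi]
      simp only [Pi.sub_apply, Pi.smul_apply, smul_eq_mul]
      rw [Matrix.mul_apply, Fin.sum_univ_succAbove _ i]
      have : (H - z • (1 : Matrix (Fin (n+1)) (Fin (n+1)) ℂ)) (i.succAbove k) i = a k := by
        simp [ha, one_apply_ne (Fin.succAbove_ne i k)]
      rw [this, mul_comm (a k), add_sub_cancel_left]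
      simp only [mulVec, dotProduct]
      refine Finset.sum_congr rfl fun l _ => ?_
      simp [hBd, Matrix.one_apply]
    have e2 := congrArg (fun w => R *ᵥ w) e1
    simp only [mulVec_mulVec, hRi, one_mulVec, mulVec_sub, mulVec_smul] at e2
    exact e2
  have main : G i i * (H i i - z - star a ⬝ᵥ R *ᵥ a) = 1 := by
    have h1 := row_i i
    have h2 := row_k i
    have : (fun k => (1 : Matrix (Fin (n+1)) (Fin (n+1)) ℂ) (i.succAbove k) i) = 0 := by
      funext k; exact one_apply_ne (Fin.succAbove_ne i k)
    rw [this, mulVec_zero, zero_sub] at h2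
    rw [h2, dotProduct_neg, dotProduct_smul, one_apply_eq, smul_eq_mul] at h1
    linear_combination h1
  refine ⟨main, ?_⟩
  have hGne : G i i ≠ 0 := by rintro h; rw [h] at main; simp at main
  have hl : ∀ l, G i (i.succAbove l) = - G i i * (star a ⬝ᵥ fun k => R k l) ∧
      G (i.succAbove l) (i.succAbove l) = R l l - G i (i.succAbove l) * (R *ᵥ a) l := by
    intro l
    have h1 := row_i (i.succAbove l)
    have h2 := row_k (i.succAbove l)
    have : (fun k => (1 : Matrix (Fin (n+1)) (Fin (n+1)) ℂ) (i.succAbove k) (i.succAbove l)) = Pi.single l 1 := by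
      funext k; simp [Matrix.one_apply, Pi.single_apply]
    rw [this, mulVec_single_one] at h2
    rw [h2, one_apply_ne (Fin.succAbove_ne i l).symm, dotProduct_sub, dotProduct_smul, smul_eq_mul] at h1
    constructor
    · have e : star a ⬝ᵥ R.col l = star a ⬝ᵥ fun k => R k l := rfl
      rw [e] at h1
      linear_combination G i i * h1 - G i (i.succAbove l) * main
    · have := congrFun h2 l
      simpa using this
  have hS : (∑ l, (star a ⬝ᵥ fun k => R k l) * (R *ᵥ a) l) = star (Rᴴ *ᵥ a) ⬝ᵥ (R *ᵥ a) := by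
    simp only [dotProduct]
    refine Finset.sum_congr rfl fun l _ => ?_
    congr 1
    simp [mulVec, dotProduct, mul_comm]
  have htr : G.trace - R.trace = G i i * (1 + star (Rᴴ *ᵥ a) ⬝ᵥ (R *ᵥ a)) := by
    rw [← hS, trace, Fin.sum_univ_succAbove _ i, trace, add_sub_assoc, ← Finset.sum_sub_distrib]
    rw [mul_add, mul_one, Finset.mul_sum]
    congr 1
    refine Finset.sum_congr rfl fun l _ => ?_
    simp only [diag_apply]
    rw [(hl l).2, (hl l).1]; ring
  set s := nsq (R *ᵥ a) with hs
  have hs0 : 0 ≤ s := nsq_nonneg _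
  have hs' : nsq (Rᴴ *ᵥ a) = s := by
    have h1 := im_Rz hB z hz.ne' a
    have h2 := im_Rz' hB z hz.ne' a
    rw [h1] at h2
    exact (mul_left_cancel₀ hz.ne' h2).symm
  have hSn : ‖star (Rᴴ *ᵥ a) ⬝ᵥ (R *ᵥ a)‖ ≤ s := by
    have := cs_dot (Rᴴ *ᵥ a) (R *ᵥ a)
    rw [hs', ← hs, ← sq] at this
    exact (sq_le_sq₀ (norm_nonneg _) hs0).1 this
  have hden : z.im * (1 + s) ≤ ‖H i i - z - star a ⬝ᵥ R *ᵥ a‖ := by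
    refine le_trans ?_ (Complex.abs_im_le_norm _)
    have h0 : (H i i).im = 0 := by
      have := congrArg Complex.im (hH.apply i i)
      simp at this; linarith
    rw [Complex.sub_im, Complex.sub_im, h0, im_Rz hB z hz.ne' a, ← hs]
    have : 0 - z.im - z.im * s = -(z.im * (1 + s)) := by ring
    rw [this, abs_neg]; exact le_abs_self _
  have hn := congrArg norm main
  rw [norm_mul, norm_one] at hn
  rw [htr, norm_mul, le_div_iff₀ hz]
  calc ‖G i i‖ * ‖1 + star (Rᴴ *ᵥ a) ⬝ᵥ (R *ᵥ a)‖ * z.im ≤ ‖G i i‖ * (1 + s) * z.im := by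
        gcongr
        exact (norm_add_le _ _).trans (by rw [norm_one]; linarith)
    _ = ‖G i i‖ * (z.im * (1 + s)) := by ring
    _ ≤ ‖G i i‖ * ‖H i i - z - star a ⬝ᵥ R *ᵥ a‖ := by gcongr
    _ = 1 := hn
end

open MeasureTheory ProbabilityTheory
open scoped ENNReal NNReal
noncomputable section
open Matrix

lemma stab (E η σ e : ℝ) (m : ℂ) (hη : 0 < η) (hη1 : η ≤ 1) (hE : |E| ≤ 2) (hσ : 0 < σ)
    (hs : σ ≤ Real.sqrt (4 - E ^ 2) / 2) (hm : 0 ≤ m.im)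
    (h : ‖m ^ 2 + (⟨E, η⟩ : ℂ) * m + 1‖ ≤ e) :
    |m.im - Real.sqrt (4 - E ^ 2) / 2| ≤ (e + 2 * η) / σ + η / 2 := by
  set s := Real.sqrt (4 - E ^ 2) / 2 with hsd
  have hE2 : 0 ≤ 4 - E ^ 2 := by nlinarith [abs_nonneg E, sq_abs E]
  have hs2 : s ^ 2 = 1 - E ^ 2 / 4 := by
    rw [hsd, div_pow, Real.sq_sqrt hE2]; ring
  set z : ℂ := ⟨E, η⟩ with hz
  set w := m + z / 2 with hw
  have e1 : (w - Complex.I * s) * (w + Complex.I * s) = (m ^ 2 + z * m + 1) + (z ^ 2 - (E : ℂ) ^ 2) / 4 := by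
    have : (s : ℂ) ^ 2 = 1 - (E : ℂ) ^ 2 / 4 := by
      rw [← Complex.ofReal_pow, hs2]; push_cast; ring
    have hI := Complex.I_sq
    rw [hw]
    linear_combination (-(s : ℂ) ^ 2) * hI + this
  have e2 : ‖(z ^ 2 - (E : ℂ) ^ 2) / 4‖ ≤ 2 * η := by
    have : z = (E : ℂ) + η * Complex.I := by
      apply Complex.ext <;> simp [hz]
    have e3 : (z ^ 2 - (E : ℂ) ^ 2) / 4 = (η : ℂ) * (2 * E * Complex.I - η) / 4 := by
      rw [this]; ring_nf; simp [Complex.I_sq]; ring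
    rw [e3, norm_div, norm_mul, Complex.norm_real, Real.norm_of_nonneg hη.le]
    have : ‖2 * (E : ℂ) * Complex.I - η‖ ≤ 5 := by
      refine (norm_sub_le _ _).trans ?_
      simp only [norm_mul, Complex.norm_real, Complex.norm_I, Real.norm_eq_abs, abs_of_pos hη]
      norm_num; linarith
    have h4 : ‖(4 : ℂ)‖ = 4 := by norm_num
    rw [h4]; nlinarith
  have e3 : ‖w - Complex.I * s‖ * ‖w + Complex.I * s‖ ≤ e + 2 * η := by
    rw [← norm_mul, e1]; exact (norm_add_le _ _).trans (add_le_add h e2)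
  have e4 : σ ≤ ‖w + Complex.I * s‖ := by
    refine le_trans ?_ ((le_abs_self _).trans (Complex.abs_im_le_norm _))
    simp [hw, hz]; linarith
  have e5 : ‖w - Complex.I * s‖ ≤ (e + 2 * η) / σ := by
    rw [le_div_iff₀ hσ]
    exact le_trans (by gcongr) e3
  have e6 := (Complex.abs_im_le_norm (w - Complex.I * s)).trans e5
  have e7 : (w - Complex.I * s).im = m.im + η / 2 - s := by simp [hw, hz]
  rw [e7] at e6
  rw [abs_le] at e6 ⊢
  constructor <;> linarith [e6.1, e6.2]

lemma selfcons {n : ℕ} (g Y : Fin (n+1) → ℂ) (m z : ℂ) (y s : ℝ) (hg : ∀ i, g i * (-(z + m + Y i)) = 1)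
    (hm : m = (∑ i, g i) / ((n : ℂ) + 1)) (hY : ∀ i, ‖Y i‖ ≤ y) (hs : s ≤ (z + m).im) (hs0 : 0 < s) (hy : 2 * y ≤ s) :
    ‖m ^ 2 + z * m + 1‖ ≤ 2 * y / s := by
  have hn : ((n : ℂ) + 1) ≠ 0 := by exact_mod_cast Nat.succ_ne_zero n
  have e : m ^ 2 + z * m + 1 = (∑ i, -(g i * Y i)) / ((n : ℂ) + 1) := by
    have e1 : ∀ i, -(g i * Y i) = g i * (z + m) + 1 := by intro i; linear_combination hg i
    simp only [e1]
    rw [Finset.sum_add_distrib, ← Finset.sum_mul]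
    simp only [Finset.sum_const, Finset.card_univ, Fintype.card_fin, nsmul_eq_mul, mul_one]
    rw [add_div, mul_div_right_comm, ← hm]
    push_cast; rw [div_self hn]; ring
  have hb : ∀ i, ‖-(g i * Y i)‖ ≤ 2 * y / s := by
    intro i
    have h1 := congrArg norm (hg i)
    rw [norm_mul, norm_neg, norm_one] at h1
    have h2 : s / 2 ≤ ‖z + m + Y i‖ := by
      refine le_trans ?_ (Complex.abs_im_le_norm _)
      refine le_trans ?_ (le_abs_self _)
      rw [Complex.add_im]
      have := (abs_le.1 ((Complex.abs_im_le_norm (Y i)).trans (hY i))).1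
      linarith
    have h3 : ‖g i‖ * (s / 2) ≤ 1 := by rw [← h1]; gcongr
    rw [norm_neg, norm_mul, le_div_iff₀ hs0]
    have hy0 : 0 ≤ y := (norm_nonneg _).trans (hY i)
    calc ‖g i‖ * ‖Y i‖ * s ≤ ‖g i‖ * y * s := by gcongr; exact hY i
      _ = (‖g i‖ * (s / 2)) * (2 * y) := by ring
      _ ≤ 1 * (2 * y) := by gcongr
      _ = _ := one_mul _
  rw [e, norm_div]
  have hnn : ‖((n : ℂ) + 1)‖ = (n : ℝ) + 1 := by
    rw [show ((n : ℂ) + 1) = ((n + 1 : ℝ) : ℂ) by push_cast; rfl, Complex.norm_real, Real.norm_of_nonneg (by positivity)]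
  rw [hnn, div_le_iff₀ (by positivity)]
  refine (norm_sum_le _ _).trans ((Finset.sum_le_sum fun i _ => hb i).trans (le_of_eq ?_))
  simp; ring

/-- the good event at one spectral parameter -/
def GoodAt {n : ℕ} (H : Matrix (Fin (n+1)) (Fin (n+1)) ℂ) (M y : ℝ) (z : ℂ) : Prop :=
  ∀ i : Fin (n+1), ‖H i i‖ ≤ y ∧
    ((Rz (H.submatrix i.succAbove i.succAbove) z).trace.im ≤ M * ((n : ℝ) + 1) →
      ‖star (fun k => H (i.succAbove k) i) ⬝ᵥ
      Rz (H.submatrix i.succAbove i.succAbove) z *ᵥ (fun k => H (i.succAbove k) i)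
        - (Rz (H.submatrix i.succAbove i.succAbove) z).trace / ((n : ℂ) + 1)‖ ≤ y)

/-- imaginary part of the Stieltjes transform -/
def pim {n : ℕ} (H : Matrix (Fin (n+1)) (Fin (n+1)) ℂ) (E η : ℝ) : ℝ :=
  (Rz H (⟨E, η⟩ : ℂ)).trace.im / ((n : ℝ) + 1)

lemma good_step {n : ℕ} {H : Matrix (Fin (n+1)) (Fin (n+1)) ℂ} (hH : H.IsHermitian) (E η M y s : ℝ)
    (hη : 0 < η) (hNη : 1 ≤ y * (((n : ℝ) + 1) * η)) (hy : y ≤ 1) (hG : GoodAt H M y ⟨E, η⟩)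
    (hM : pim H E η ≤ M - 1) (hs0 : 0 < s) (hs : s ≤ η + pim H E η) (hys : 6 * y ≤ s) :
    ∃ m : ℂ, m.im = pim H E η ∧ ‖m ^ 2 + (⟨E, η⟩ : ℂ) * m + 1‖ ≤ 6 * y / s := by
  set z : ℂ := ⟨E, η⟩ with hz
  have hzi : z.im = η := rfl
  set m : ℂ := (Rz H z).trace / ((n : ℂ) + 1) with hm
  have hN : (0 : ℝ) < (n : ℝ) + 1 := by positivity
  have hcast : ((n : ℂ) + 1) = ((n + 1 : ℝ) : ℂ) := by push_cast; rfl
  have hmim : m.im = pim H E η := by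
    rw [hm, hcast, Complex.div_ofReal_im, pim]
  refine ⟨m, hmim, ?_⟩
  have h6 : 6 * y / s = 2 * (3 * y) / s := by ring
  rw [h6]
  have hinv : 1 / η ≤ y * ((n : ℝ) + 1) := by
    rw [div_le_iff₀ hη]; linarith
  refine selfcons (fun i => Rz H z i i) (fun i => star (fun k => H (i.succAbove k) i) ⬝ᵥ
      Rz (H.submatrix i.succAbove i.succAbove) z *ᵥ (fun k => H (i.succAbove k) i) - m - H i i) m z (3 * y) s ?_ ?_ ?_ ?_ hs0 (by linarith)
  · intro i
    rw [← (schur hH i z hη).1]; ring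
  · rw [hm]; rfl
  · intro i
    have hsch := (schur hH i z hη).2
    rw [hzi] at hsch
    obtain ⟨g1, g2⟩ := hG i
    set R := Rz (H.submatrix i.succAbove i.succAbove) z with hR
    have him : R.trace.im ≤ M * ((n : ℝ) + 1) := by
      have h1 := (abs_le.1 ((Complex.abs_im_le_norm _).trans hsch)).1
      rw [Complex.sub_im] at h1
      have h2 : (Rz H z).trace.im ≤ (M - 1) * ((n : ℝ) + 1) := by
        rw [pim, div_le_iff₀ hN] at hM; exact hM
      have h3 : y * ((n : ℝ) + 1) ≤ 1 * ((n : ℝ) + 1) := by gcongr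
      linarith
    have g3 := g2 him
    have g4 : ‖R.trace / ((n : ℂ) + 1) - m‖ ≤ y := by
      rw [hm, ← sub_div, norm_div, norm_sub_rev, hcast, Complex.norm_real, Real.norm_of_nonneg hN.le, div_le_iff₀ hN]
      exact hsch.trans hinv
    calc _ = ‖(star (fun k => H (i.succAbove k) i) ⬝ᵥ R *ᵥ (fun k => H (i.succAbove k) i) - R.trace / ((n : ℂ) + 1)) + (R.trace / ((n : ℂ) + 1) - m) - H i i‖ := by
          congr 1; ring
      _ ≤ y + y + y := (norm_sub_le _ _).trans (add_le_add ((norm_add_le _ _).trans (add_le_add g3 g4)) g1)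
      _ = 3 * y := by ring
  · rw [Complex.add_im, hzi, hmim]; exact hs

lemma pim_eq {n : ℕ} {H : Matrix (Fin (n+1)) (Fin (n+1)) ℂ} (hH : H.IsHermitian) (E η : ℝ) (hη : 0 < η) :
    pim H E η = (∑ j, η / ((hH.eigenvalues j - E) ^ 2 + η ^ 2)) / ((n : ℝ) + 1) := by
  rw [pim, im_trace_Rz hH E η hη]

lemma pim_nonneg {n : ℕ} {H : Matrix (Fin (n+1)) (Fin (n+1)) ℂ} (hH : H.IsHermitian) (E η : ℝ) (hη : 0 < η) :
    0 ≤ pim H E η := by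
  rw [pim_eq hH E η hη]; positivity

lemma pim_le {n : ℕ} {H : Matrix (Fin (n+1)) (Fin (n+1)) ℂ} (hH : H.IsHermitian) (E η : ℝ) (hη : 0 < η) :
    pim H E η ≤ 1 / η := by
  rw [pim_eq hH E η hη, div_le_iff₀ (by positivity)]
  calc _ ≤ ∑ j : Fin (n+1), 1 / η := by
        refine Finset.sum_le_sum fun j _ => ?_
        rw [div_le_div_iff₀ (by positivity) hη]; nlinarith [sq_nonneg (hH.eigenvalues j - E)]
    _ = _ := by simp; ring

lemma pim_double {n : ℕ} {H : Matrix (Fin (n+1)) (Fin (n+1)) ℂ} (hH : H.IsHermitian) (E η : ℝ) (hη : 0 < η) :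
    pim H E η ≤ 2 * pim H E (2 * η) ∧ pim H E (2 * η) ≤ 2 * pim H E η := by
  rw [pim_eq hH E η hη, pim_eq hH E (2 * η) (by positivity), ← mul_div_assoc, ← mul_div_assoc]
  constructor
  · gcongr; rw [Finset.mul_sum]
    refine Finset.sum_le_sum fun j _ => ?_
    rw [← mul_div_assoc, div_le_div_iff₀ (by positivity) (by positivity)]
    nlinarith [mul_nonneg hη.le (sq_nonneg (hH.eigenvalues j - E))]
  · gcongr; rw [Finset.mul_sum]
    refine Finset.sum_le_sum fun j _ => ?_
    rw [← mul_div_assoc]; gcongr; linarith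

lemma sqrt_le_one_aux (E : ℝ) : Real.sqrt (4 - E ^ 2) / 2 ≤ 1 := by
  have : Real.sqrt (4 - E ^ 2) ≤ Real.sqrt (2 ^ 2) := Real.sqrt_le_sqrt (by nlinarith [sq_nonneg E])
  rw [Real.sqrt_sq (by norm_num)] at this; linarith

lemma scale_induct {n : ℕ} {H : Matrix (Fin (n+1)) (Fin (n+1)) ℂ} (hH : H.IsHermitian)
    (E σ η0 y δ1 s e : ℝ) (hE : |E| ≤ 2) (hσ : 0 < σ) (hσs : σ ≤ Real.sqrt (4 - E ^ 2) / 2)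
    (hη0 : 0 < η0) (hη01 : η0 ≤ 1) (hy1 : y ≤ 1) (hs0 : 0 < s) (hs1 : s ≤ η0 / 2) (hs2 : s ≤ σ / 4)
    (hys : 6 * y ≤ s) (he : 6 * y / s ≤ e) (hδ : (e + 2 * η0) / σ + η0 / 2 ≤ δ1) (hδ1 : δ1 ≤ σ / 2) :
    ∀ (k : ℕ) (η : ℝ), 0 < η → 1 ≤ y * (((n : ℝ) + 1) * η) → η0 / 2 ≤ 2 ^ k * η → 2 ^ k * η ≤ η0 →
      (∀ j ≤ k, GoodAt H (2 / η0 + 5) y ⟨E, 2 ^ j * η⟩) →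
      |pim H E η - Real.sqrt (4 - E ^ 2) / 2| ≤ δ1 := by
  have fin : ∀ η : ℝ, 0 < η → η ≤ η0 → 1 ≤ y * (((n : ℝ) + 1) * η) → GoodAt H (2 / η0 + 5) y ⟨E, η⟩ →
      pim H E η ≤ (2 / η0 + 5) - 1 → s ≤ η + pim H E η →
      |pim H E η - Real.sqrt (4 - E ^ 2) / 2| ≤ δ1 := by
    intro η hη hηle hN hG hM hs
    obtain ⟨m, hm, hmm⟩ := good_step hH E η _ y s hη hN hy1 hG hM hs0 hs hys
    have := stab E η σ e m hη (hηle.trans hη01) hE hσ hσs (by rw [hm]; exact pim_nonneg hH E η hη) (hmm.trans he)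
    rw [hm] at this
    refine this.trans (le_trans ?_ hδ)
    gcongr
  intro k
  induction k with
  | zero =>
    intro η hη hN h1 h2 hG
    simp only [pow_zero, one_mul] at h1 h2
    refine fin η hη h2 hN (by simpa using hG 0 le_rfl) ?_ ?_
    · refine (pim_le hH E η hη).trans ?_
      have : 1 / η ≤ 1 / (η0 / 2) := by gcongr
      have e2 : 1 / (η0 / 2) = 2 / η0 := by field_simp
      linarith
    · have := pim_nonneg hH E η hη; linarith
  | succ k ih =>
    intro η hη hN h1 h2 hG
    have hy0 : 0 < y := by
      by_contra h
      have : y * (((n : ℝ) + 1) * η) ≤ 0 := mul_nonpos_of_nonpos_of_nonneg (not_lt.1 h) (by positivity)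
      linarith
    have e1 : ∀ j : ℕ, (2 : ℝ) ^ j * (2 * η) = 2 ^ (j + 1) * η := fun j => by ring
    have h := ih (2 * η) (by positivity) (by nlinarith [mul_pos hy0 (mul_pos (by positivity : (0:ℝ) < (n : ℝ) + 1) hη)]) (by rw [e1]; exact h1) (by rw [e1]; exact h2)
      (by intro j hj; rw [e1]; exact hG (j + 1) (by omega))
    obtain ⟨d1, d2⟩ := pim_double hH E η hη
    rw [abs_le] at h
    have hle1 := sqrt_le_one_aux E
    have hηle : η ≤ η0 := by
      have : (1 : ℝ) ≤ 2 ^ (k + 1) := one_le_pow₀ (by norm_num)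
      nlinarith
    refine fin η hη hηle hN (by simpa using hG 0 (Nat.zero_le _)) ?_ ?_
    · have : 0 < 2 / η0 := by positivity
      have : 2 ≤ 2 / η0 := by rw [le_div_iff₀ hη0]; linarith
      linarith [h.2]
    · linarith [h.1]
end

open MeasureTheory ProbabilityTheory
open scoped ENNReal NNReal
noncomputable section

lemma deriv_at (lam η x : ℝ) (hη : 0 < η) :
    HasDerivAt (fun x => Real.arctan ((x - lam) / η)) (η / ((lam - x) ^ 2 + η ^ 2)) x := by
  have h := (((hasDerivAt_id x).sub_const lam).div_const η).arctan
  refine h.congr_deriv ?_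
  have : (lam - x) ^ 2 + η ^ 2 ≠ 0 := by positivity
  have h2 : 1 + ((x - lam) / η) ^ 2 ≠ 0 := by positivity
  simp only [id]
  rw [div_mul_div_comm, div_eq_div_iff (by positivity) this]
  field_simp; ring

lemma arctan_ge (x : ℝ) (hx : 0 < x) : Real.pi / 2 - 1 / x ≤ Real.arctan x := by
  have h := Real.arctan_inv_of_pos hx
  have h2 : Real.arctan x⁻¹ ≤ x⁻¹ := by
    have := Real.le_tan (Real.arctan_nonneg.2 (by positivity : 0 ≤ x⁻¹)) (Real.arctan_lt_pi_div_two _)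
    rwa [Real.tan_arctan] at this
  rw [one_div]; linarith

lemma kern_aux (x l E τ ηs η : ℝ) (hτ : 0 < τ) (hηs : 0 < ηs) (hηp : 0 < η) (hτ2 : τ ^ 2 ≤ 1 / 16)
    (t1 : τ * ηs ≤ |x - l|) (t2 : |l - E| ≤ |x - l| + ηs / 2) :
    η / ((l - x) ^ 2 + η ^ 2) ≤ (4 * η / τ ^ 2) / ((l - E) ^ 2 + ηs ^ 2) := by
  have hX2 : (l - x) ^ 2 = |x - l| ^ 2 := by rw [sq_abs]; ring
  have t3 : (l - E) ^ 2 ≤ (|x - l| + ηs / 2) ^ 2 := by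
    rw [← sq_abs (l - E)]; gcongr
  have t4 : τ ^ 2 * ηs ^ 2 ≤ |x - l| ^ 2 := by
    rw [← mul_pow]; gcongr
  have hY0 : 0 ≤ (l - E) ^ 2 := sq_nonneg _
  rw [hX2]
  generalize |x - l| = X at *
  generalize (l - E) ^ 2 = Y at *
  have hXp : 0 < X := lt_of_lt_of_le (by positivity) t1
  have hY : Y ≤ 2 * X ^ 2 + ηs ^ 2 / 2 := by
    have : (X + ηs / 2) ^ 2 = 2 * X ^ 2 + ηs ^ 2 / 2 - (X - ηs / 2) ^ 2 := by ring
    have h2 := sq_nonneg (X - ηs / 2)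
    linarith
  have hX0 : 0 < X ^ 2 := by positivity
  have t5 : τ ^ 2 * (Y + ηs ^ 2) ≤ 4 * X ^ 2 := by
    calc τ ^ 2 * (Y + ηs ^ 2) ≤ τ ^ 2 * (2 * X ^ 2 + ηs ^ 2 / 2 + ηs ^ 2) := by gcongr
      _ = 2 * (τ ^ 2 * X ^ 2) + 3 / 2 * (τ ^ 2 * ηs ^ 2) := by ring
      _ ≤ 2 * ((1 / 16) * X ^ 2) + 3 / 2 * X ^ 2 := by gcongr
      _ ≤ _ := by linarith
  rw [div_div, div_le_div_iff₀ (by positivity) (by positivity)]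
  calc η * (τ ^ 2 * (Y + ηs ^ 2)) ≤ η * (4 * X ^ 2) := by gcongr
    _ ≤ 4 * η * (X ^ 2 + η ^ 2) := by
        have : 0 < η * η ^ 2 := by positivity
        linarith

set_option maxHeartbeats 2000000 in
lemma count_lemma {N : ℕ} (hN : 0 < N) (lam : Fin N → ℝ) (τ ηs E S d : ℝ) (hτ : 0 < τ) (hτ4 : τ ≤ 1 / 4) (hηs : 0 < ηs)
    (hS0 : 0 ≤ S) (hS1 : S ≤ 1) (hd0 : 0 ≤ d) (hd1 : d ≤ 1)
    (h : ∀ x, |x - E| ≤ ηs → |(∑ j, (τ ^ 3 * ηs) / ((lam j - x) ^ 2 + (τ ^ 3 * ηs) ^ 2)) / N - S| ≤ d)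
    (h2 : (∑ j, ηs / ((lam j - E) ^ 2 + ηs ^ 2)) / N ≤ 2) (A : Finset (Fin N))
    (hA : ∀ j, j ∈ A ↔ lam j ∈ Set.Icc (E - ηs / 2) (E + ηs / 2)) :
    |Real.pi * ((A.card : ℝ) / (N * ηs)) - S| ≤ d + 10 * τ := by
  set η := τ ^ 3 * ηs with hη
  have hηp : 0 < η := by positivity
  have hNp : (0 : ℝ) < N := by exact_mod_cast hN
  set r := τ * ηs with hr
  have hrp : 0 < r := by positivity
  have hr4 : r ≤ ηs / 4 := by nlinarith
  have hpi := Real.pi_gt_three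
  set F : ℝ → ℝ := fun x => (∑ j, Real.arctan ((x - lam j) / η)) / N with hF
  have hFd : ∀ x, HasDerivAt F ((∑ j, η / ((lam j - x) ^ 2 + η ^ 2)) / N) x := by
    intro x
    exact (HasDerivAt.fun_sum fun j _ => deriv_at (lam j) η x hηp).div_const _
  have hmv : ∀ a b, a ≤ b → |a - E| ≤ ηs → |b - E| ≤ ηs → |F b - F a - S * (b - a)| ≤ d * (b - a) := by
    intro a b hab ha hb
    have := Convex.norm_image_sub_le_of_norm_hasDerivWithin_le (f := fun x => F x - S * x)
      (f' := fun x => (∑ j, η / ((lam j - x) ^ 2 + η ^ 2)) / N - S) (s := Set.Icc a b) (x := a) (y := b) (C := d)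
      (fun x hx => ((hFd x).sub ((hasDerivAt_id x).const_mul S |>.congr_deriv (mul_one S))).hasDerivWithinAt)
      (fun x hx => by
        rw [Real.norm_eq_abs]; apply h
        rw [abs_le] at *
        constructor <;> linarith [hx.1, hx.2, ha.1, hb.2]) (convex_Icc a b) (Set.left_mem_Icc.2 hab) (Set.right_mem_Icc.2 hab)
    rw [Real.norm_eq_abs, Real.norm_eq_abs, abs_of_nonneg (sub_nonneg.2 hab)] at this
    convert this using 2; ring
  have hmono : ∀ j a b, a ≤ b → Real.arctan ((a - lam j) / η) ≤ Real.arctan ((b - lam j) / η) := by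
    intro j a b hab
    apply Real.arctan_mono; gcongr
  set q := (A.card : ℝ) / (N * ηs) with hq
  have hq0 : 0 ≤ q := by positivity
  have hcard : (A.card : ℝ) = q * (N * ηs) := by rw [hq]; field_simp
  have hηr : 1 / (r / η) = τ ^ 2 := by rw [hη, hr]; field_simp
  have hτ2 : τ ^ 2 ≤ 1 / 16 := by nlinarith
  -- upper
  have up : Real.pi * q ≤ S + d + 5 * τ := by
    set a := E - ηs / 2 - r with ha
    set b := E + ηs / 2 + r with hb
    have h1 := (abs_le.1 (hmv a b (by linarith) (by rw [abs_le]; constructor <;> linarith) (by rw [abs_le]; constructor <;> linarith))).2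
    have h3 : (A.card : ℝ) * (Real.pi - 2 * τ ^ 2) ≤ N * (F b - F a) := by
      have e1 : N * (F b - F a) = ∑ j, (Real.arctan ((b - lam j) / η) - Real.arctan ((a - lam j) / η)) := by
        rw [Finset.sum_sub_distrib, hF]; field_simp
      rw [e1]
      calc (A.card : ℝ) * (Real.pi - 2 * τ ^ 2) = ∑ j ∈ A, (Real.pi - 2 * τ ^ 2) := by rw [Finset.sum_const, nsmul_eq_mul]
        _ ≤ ∑ j ∈ A, (Real.arctan ((b - lam j) / η) - Real.arctan ((a - lam j) / η)) := by
          refine Finset.sum_le_sum fun j hj => ?_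
          have hj' := (hA j).1 hj
          have g1 : Real.arctan (r / η) ≤ Real.arctan ((b - lam j) / η) := by
            apply Real.arctan_mono; gcongr; linarith [hj'.2]
          have g2 : Real.arctan ((a - lam j) / η) ≤ Real.arctan (-(r / η)) := by
            apply Real.arctan_mono; rw [← neg_div]; gcongr; linarith [hj'.1]
          have g3 := arctan_ge (r / η) (by positivity)
          rw [hηr] at g3
          rw [Real.arctan_neg] at g2
          linarith
        _ ≤ _ := Finset.sum_le_univ_sum_of_nonneg fun j => sub_nonneg.2 (hmono j a b (by linarith))
    rw [hcard] at h3
    have h4 : q * ηs * (Real.pi - 2 * τ ^ 2) ≤ F b - F a := by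
      have : N * (q * ηs * (Real.pi - 2 * τ ^ 2)) ≤ N * (F b - F a) := by linarith
      exact le_of_mul_le_mul_left this hNp
    have h5 : q * (Real.pi - 2 * τ ^ 2) ≤ (S + d) * (1 + 2 * τ) := by
      have hba : b - a = ηs * (1 + 2 * τ) := by rw [ha, hb, hr]; ring
      rw [hba] at h1
      have : ηs * (q * (Real.pi - 2 * τ ^ 2)) ≤ ηs * ((S + d) * (1 + 2 * τ)) := by linarith
      exact le_of_mul_le_mul_left this hηs
    have h6 : q * (Real.pi - 2 * τ ^ 2) ≤ S + d + 4 * τ := by nlinarith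
    have h7 : q ≤ 2 := by nlinarith
    nlinarith
  have low : S - d - 10 * τ ≤ Real.pi * q := by
    set a := E - ηs / 2 + r with ha
    set b := E + ηs / 2 - r with hb
    have hab : a ≤ b := by linarith
    have h1 := (abs_le.1 (hmv a b hab (by rw [abs_le]; constructor <;> linarith) (by rw [abs_le]; constructor <;> linarith))).1
    have h3 : N * (F b - F a) ≤ (A.card : ℝ) * Real.pi + 8 * τ * ηs * N := by
      have e1 : N * (F b - F a) = ∑ j, (Real.arctan ((b - lam j) / η) - Real.arctan ((a - lam j) / η)) := by
        rw [Finset.sum_sub_distrib, hF]; field_simp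
      rw [e1]
      calc _ ≤ ∑ j, ((if j ∈ A then Real.pi else 0) + (4 * η / τ ^ 2) * (ηs / ((lam j - E) ^ 2 + ηs ^ 2))) := by
            refine Finset.sum_le_sum fun j _ => ?_
            have p0 : 0 ≤ (4 * η / τ ^ 2) * (ηs / ((lam j - E) ^ 2 + ηs ^ 2)) := by positivity
            by_cases hj : j ∈ A
            · rw [if_pos hj]
              have g1 := Real.arctan_lt_pi_div_two ((b - lam j) / η)
              have g2 := Real.neg_pi_div_two_lt_arctan ((a - lam j) / η)
              linarith
            · rw [if_neg hj, zero_add]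
              have hj' : ¬ (E - ηs / 2 ≤ lam j ∧ lam j ≤ E + ηs / 2) := fun hh => hj ((hA j).2 hh)
              have hout : ∀ x ∈ Set.Icc a b, r ≤ |x - lam j| ∧ |lam j - E| ≤ |x - lam j| + ηs / 2 := by
                intro x hx
                have hx1 := hx.1
                have hx2 := hx.2
                constructor
                · by_contra hcon
                  rw [not_le, abs_lt] at hcon
                  exact hj' ⟨by linarith [hcon.2], by linarith [hcon.1]⟩
                · have t1 : |lam j - E| ≤ |lam j - x| + |x - E| := abs_sub_le _ _ _
                  have t2 : |x - E| ≤ ηs / 2 := by rw [abs_le]; constructor <;> linarith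
                  rw [abs_sub_comm (lam j) x] at t1; linarith
              set K := (4 * η / τ ^ 2) / ((lam j - E) ^ 2 + ηs ^ 2) with hK
              have hder : ∀ x ∈ Set.Icc a b, η / ((lam j - x) ^ 2 + η ^ 2) ≤ K := by
                intro x hx
                obtain ⟨t1, t2⟩ := hout x hx
                exact kern_aux _ _ _ _ _ _ hτ hηs hηp hτ2 t1 t2
              have := Convex.norm_image_sub_le_of_norm_hasDerivWithin_le (f := fun x => Real.arctan ((x - lam j) / η))
                (f' := fun x => η / ((lam j - x) ^ 2 + η ^ 2)) (s := Set.Icc a b) (x := a) (y := b) (C := K)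
                (fun x hx => (deriv_at (lam j) η x hηp).hasDerivWithinAt)
                (fun x hx => by
                  rw [Real.norm_of_nonneg (by positivity)]; exact hder x hx) (convex_Icc a b) (Set.left_mem_Icc.2 hab) (Set.right_mem_Icc.2 hab)
              rw [Real.norm_eq_abs, Real.norm_eq_abs, abs_of_nonneg (sub_nonneg.2 hab)] at this
              have hK0 : 0 ≤ K := by positivity
              calc _ ≤ K * (b - a) := (le_abs_self _).trans this
                _ ≤ K * ηs := by gcongr; linarith
                _ = _ := by rw [hK]; ring
        _ = (A.card : ℝ) * Real.pi + (4 * η / τ ^ 2) * ∑ j, ηs / ((lam j - E) ^ 2 + ηs ^ 2) := by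
            rw [Finset.sum_add_distrib, ← Finset.mul_sum]; congr 1; simp
        _ ≤ (A.card : ℝ) * Real.pi + (4 * η / τ ^ 2) * (2 * N) := by
            gcongr; rwa [div_le_iff₀ hNp] at h2
        _ = _ := by rw [hη]; field_simp; ring
    rw [hcard] at h3
    have h4 : F b - F a ≤ q * ηs * Real.pi + 8 * τ * ηs := by
      have : N * (F b - F a) ≤ N * (q * ηs * Real.pi + 8 * τ * ηs) := by linarith
      exact le_of_mul_le_mul_left this hNp
    have h5 : (S - d) * (1 - 2 * τ) ≤ q * Real.pi + 8 * τ := by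
      have hba : b - a = ηs * (1 - 2 * τ) := by rw [ha, hb, hr]; ring
      rw [hba] at h1
      have : ηs * ((S - d) * (1 - 2 * τ)) ≤ ηs * (q * Real.pi + 8 * τ) := by linarith
      exact le_of_mul_le_mul_left this hηs
    nlinarith
  rw [abs_le]; constructor <;> linarith
end

open MeasureTheory ProbabilityTheory
open scoped ENNReal NNReal
noncomputable section
open Matrix

def Au {n : ℕ} (R : Matrix (Fin n) (Fin n) ℂ) (w : ℂ) : Matrix (Fin n) (Fin n) ℂ :=
  Matrix.of fun k l => (w * R k l + star (w * R l k)) / 2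

lemma Au_herm {n : ℕ} (R : Matrix (Fin n) (Fin n) ℂ) (w : ℂ) : (Au R w).IsHermitian := by
  ext k l
  simp only [Au, Matrix.conjTranspose_apply, Matrix.of_apply]
  simp [add_comm]

lemma Au_qf {n : ℕ} (R : Matrix (Fin n) (Fin n) ℂ) (w : ℂ) (v : Fin n → ℂ) :
    qf (Au R w) v = (w * (star v ⬝ᵥ R *ᵥ v)).re := by
  have e1 : (w * (star v ⬝ᵥ R *ᵥ v)).re = ∑ k, ∑ l, (star (v k) * (w * R k l) * v l).re := by
    simp only [dotProduct, mulVec, Finset.mul_sum, Complex.re_sum, Pi.star_apply]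
    refine Finset.sum_congr rfl fun k _ => Finset.sum_congr rfl fun l _ => ?_
    congr 1; ring
  have e2 : (w * (star v ⬝ᵥ R *ᵥ v)).re = ∑ k, ∑ l, (star (v k) * star (w * R l k) * v l).re := by
    rw [e1, Finset.sum_comm]
    refine Finset.sum_congr rfl fun k _ => Finset.sum_congr rfl fun l _ => ?_
    have : star (v k) * star (w * R l k) * v l = star (star (v l) * (w * R l k) * v k) := by
      simp [mul_comm, mul_assoc, mul_left_comm]
    rw [this]
    simp only [Complex.star_def, Complex.conj_re]
  have : (w * (star v ⬝ᵥ R *ᵥ v)).re = ((w * (star v ⬝ᵥ R *ᵥ v)).re + (w * (star v ⬝ᵥ R *ᵥ v)).re) / 2 := by ring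
  rw [this]
  nth_rw 1 [e1]
  rw [e2]
  rw [← Finset.sum_add_distrib, Finset.sum_div]
  refine Finset.sum_congr rfl fun k _ => ?_
  rw [← Finset.sum_add_distrib, Finset.sum_div]
  refine Finset.sum_congr rfl fun l _ => ?_
  simp only [Au, Matrix.of_apply]
  have : star (v k) * ((w * R k l + star (w * R l k)) / 2) * v l
    = ((1 / 2 : ℝ) : ℂ) * (star (v k) * (w * R k l) * v l + star (v k) * star (w * R l k) * v l) := by
    push_cast; ring
  rw [this, Complex.re_ofReal_mul, Complex.add_re]; ring

lemma Au_trr {n : ℕ} (R : Matrix (Fin n) (Fin n) ℂ) (w : ℂ) :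
    trr (Au R w) = (w * R.trace).re := by
  simp only [trr, trace, diag_apply, Finset.mul_sum, Complex.re_sum, Au, of_apply]
  refine Finset.sum_congr rfl fun k _ => ?_
  have : (w * R k k + star (w * R k k)) / 2 = (((w * R k k).re : ℝ) : ℂ) := by
    rw [Complex.star_def, Complex.add_conj]; push_cast; ring
  rw [this]; simp only [Complex.ofReal_re]

lemma Au_hs2 {n : ℕ} (R : Matrix (Fin n) (Fin n) ℂ) (w : ℂ) :
    hs2 (Au R w) ≤ ‖w‖ ^ 2 * hs2 R := by
  have h1 : ‖w‖ ^ 2 * hs2 R = ∑ k, ∑ l, ‖w * R k l‖ ^ 2 := by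
    simp only [hs2, Finset.mul_sum, norm_mul, mul_pow]
  have h2 : ‖w‖ ^ 2 * hs2 R = ∑ k, ∑ l, ‖w * R l k‖ ^ 2 := by
    rw [h1, Finset.sum_comm]
  have : ‖w‖ ^ 2 * hs2 R = (‖w‖ ^ 2 * hs2 R + ‖w‖ ^ 2 * hs2 R) / 2 := by ring
  rw [this]
  nth_rw 1 [h1]
  rw [h2]
  rw [← Finset.sum_add_distrib, Finset.sum_div]
  refine Finset.sum_le_sum fun k _ => ?_
  rw [← Finset.sum_add_distrib, Finset.sum_div]
  refine Finset.sum_le_sum fun l _ => ?_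
  simp only [Au, of_apply]
  have h3 : ‖(w * R k l + star (w * R l k)) / 2‖ ≤ (‖w * R k l‖ + ‖w * R l k‖) / 2 := by
    rw [norm_div, Complex.norm_two]
    gcongr
    refine (norm_add_le _ _).trans (by rw [norm_star])
  calc _ ≤ ((‖w * R k l‖ + ‖w * R l k‖) / 2) ^ 2 := by gcongr
    _ ≤ _ := by nlinarith [sq_nonneg (‖w * R k l‖ - ‖w * R l k‖)]

lemma one_dir (C lam : ℝ) (hC : 0 < C) (hl : 0 < lam) (hlC : 2 * C * lam ≤ 1)
    {n : ℕ} (ν : Fin n → Measure ℂ) (hp : ∀ k, IsProbabilityMeasure (ν k)) (hν : ∀ k, SGc (ν k) C lam)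
    (B : Matrix (Fin n) (Fin n) ℂ) (hB : B.IsHermitian) (z : ℂ) (hz : 0 < z.im) (M y t : ℝ) (ht0 : 0 < t) (ht1 : t ≤ 1)
    (htM : t * M ≤ y / 4) (hM : (Rz B z).trace.im ≤ M * ((n : ℝ) + 1)) (u : ℂ) (hu : ‖u‖ = 1) :
    Measure.pi ν {v | y / 2 * ((n : ℝ) + 1) ≤ (u * (star v ⬝ᵥ Rz B z *ᵥ v - (Rz B z).trace)).re}
      ≤ ENNReal.ofReal (Real.exp (-(lam * t * y / 4 * (((n : ℝ) + 1) * z.im)))) := by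
  set θ := lam * t * z.im with hθ
  have hθp : 0 < θ := by positivity
  set w : ℂ := θ * u with hw
  have hwn : ‖w‖ = θ := by rw [hw, norm_mul, hu, mul_one, Complex.norm_real, Real.norm_of_nonneg hθp.le]
  have hre : ∀ x : ℂ, (w * x).re = θ * (u * x).re := by
    intro x; rw [hw, mul_assoc, Complex.re_ofReal_mul]
  have hb : ∀ v, |qf (Au (Rz B z) w) v| ≤ lam * nsq v := by
    intro v
    rw [Au_qf]
    calc _ ≤ ‖w * (star v ⬝ᵥ Rz B z *ᵥ v)‖ := Complex.abs_re_le_norm _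
      _ = θ * ‖star v ⬝ᵥ Rz B z *ᵥ v‖ := by rw [norm_mul, hwn]
      _ ≤ θ * (nsq v / z.im) := by gcongr; exact nsq_Rz_le hB z hz v
      _ = (lam * nsq v) * t := by rw [hθ]; field_simp
      _ ≤ (lam * nsq v) * 1 := by
        have := nsq_nonneg v
        gcongr
      _ = _ := mul_one _
  have h := hw_tail C lam hC hl hlC ν hp hν (Au (Rz B z) w) (Au_herm _ _) hb (θ * (y / 2 * ((n : ℝ) + 1)))
  have hset : {v | y / 2 * ((n : ℝ) + 1) ≤ (u * (star v ⬝ᵥ Rz B z *ᵥ v - (Rz B z).trace)).re}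
     ⊆ {v | θ * (y / 2 * ((n : ℝ) + 1)) ≤ qf (Au (Rz B z) w) v - trr (Au (Rz B z) w)} := by
    intro v hv
    simp only [Set.mem_setOf_eq] at hv ⊢
    rw [Au_qf, Au_trr, ← Complex.sub_re, ← mul_sub, hre]
    gcongr
  refine (measure_mono hset).trans (h.trans ?_)
  apply ENNReal.ofReal_le_ofReal
  apply Real.exp_le_exp.2
  have hh := Au_hs2 (Rz B z) w
  rw [hwn] at hh
  have hs := hs2_Rz hB z hz
  rw [hs] at hM
  set S := hs2 (Rz B z)
  have h3 : 2 * C * hs2 (Au (Rz B z) w) ≤ lam * t * z.im * (y / 4) * ((n : ℝ) + 1) := by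
    calc 2 * C * hs2 (Au (Rz B z) w) ≤ 2 * C * (θ ^ 2 * S) := by gcongr
      _ = (2 * C * lam) * (t * θ) * (z.im * S) := by rw [hθ]; ring
      _ ≤ 1 * (t * θ) * (M * ((n : ℝ) + 1)) := by
        have : 0 ≤ S := Finset.sum_nonneg fun _ _ => Finset.sum_nonneg fun _ _ => by positivity
        gcongr
      _ = θ * ((t * M) * ((n : ℝ) + 1)) := by ring
      _ ≤ θ * (y / 4 * ((n : ℝ) + 1)) := by gcongr
      _ = _ := by rw [hθ]; ring
  have h4 : θ * (y / 2 * ((n : ℝ) + 1)) = 2 * (lam * t * z.im * (y / 4) * ((n : ℝ) + 1)) := by rw [hθ]; ring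
  rw [h4]
  linarith

lemma tail_fixed (C lam : ℝ) (hC : 0 < C) (hl : 0 < lam) (hlC : 2 * C * lam ≤ 1)
    {n : ℕ} (ν : Fin n → Measure ℂ) (hp : ∀ k, IsProbabilityMeasure (ν k)) (hν : ∀ k, SGc (ν k) C lam)
    (B : Matrix (Fin n) (Fin n) ℂ) (hB : B.IsHermitian) (z : ℂ) (hz : 0 < z.im) (M y t : ℝ) (ht0 : 0 < t) (ht1 : t ≤ 1)
    (htM : t * M ≤ y / 4) (hM : (Rz B z).trace.im ≤ M * ((n : ℝ) + 1)) :
    Measure.pi ν {v | y * ((n : ℝ) + 1) < ‖star v ⬝ᵥ Rz B z *ᵥ v - (Rz B z).trace‖}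
      ≤ 4 * ENNReal.ofReal (Real.exp (-(lam * t * y / 4 * (((n : ℝ) + 1) * z.im)))) := by
  have key := one_dir C lam hC hl hlC ν hp hν B hB z hz M y t ht0 ht1 htM hM
  set S : ℂ → Set (Fin n → ℂ) := fun u => {v | y / 2 * ((n : ℝ) + 1) ≤ (u * (star v ⬝ᵥ Rz B z *ᵥ v - (Rz B z).trace)).re} with hS
  have hsub : {v | y * ((n : ℝ) + 1) < ‖star v ⬝ᵥ Rz B z *ᵥ v - (Rz B z).trace‖} ⊆ (S 1 ∪ S (-1)) ∪ (S Complex.I ∪ S (-Complex.I)) := by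
    intro v hv
    simp only [hS, Set.mem_setOf_eq, Set.mem_union] at hv ⊢
    set x := star v ⬝ᵥ Rz B z *ᵥ v - (Rz B z).trace
    have h1 := Complex.norm_le_abs_re_add_abs_im x
    simp only [one_mul, neg_mul, Complex.neg_re, Complex.I_mul_re, neg_neg]
    by_contra hcon
    push Not at hcon
    obtain ⟨⟨a1, a2⟩, a3, a4⟩ := hcon
    have b1 : |x.re| < y / 2 * ((n : ℝ) + 1) := abs_lt.2 ⟨by linarith, by linarith⟩
    have b2 : |x.im| < y / 2 * ((n : ℝ) + 1) := abs_lt.2 ⟨by linarith, by linarith⟩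
    linarith
  set b := ENNReal.ofReal (Real.exp (-(lam * t * y / 4 * (((n : ℝ) + 1) * z.im))))
  calc _ ≤ Measure.pi ν ((S 1 ∪ S (-1)) ∪ (S Complex.I ∪ S (-Complex.I))) := measure_mono hsub
    _ ≤ (b + b) + (b + b) := by
      refine (measure_union_le _ _).trans (add_le_add ((measure_union_le _ _).trans (add_le_add ?_ ?_)) ((measure_union_le _ _).trans (add_le_add ?_ ?_)))
      all_goals exact key _ (by simp)
    _ = 4 * b := by ring
end

open MeasureTheory ProbabilityTheory
open scoped ENNReal NNReal
noncomputable section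
open Matrix

lemma Meas_star {α : Type*} [MeasurableSpace α] {f : α → ℂ} (hf : Measurable f) : Measurable fun x => star (f x) :=
  continuous_star.measurable.comp hf

abbrev UIdx (N : ℕ) := {p : Fin N × Fin N // p.1 ≤ p.2}

lemma wig_entry_aem {Ω : Type} [MeasurableSpace Ω] {P : Measure Ω} {N : ℕ} (hN : 0 < N)
    {H : Ω → Matrix (Fin N) (Fin N) ℂ} {ν : Measure ℂ} {ν' : Measure ℝ} (hW : IsWignerMatrix P N H ν ν')
    (p : UIdx N) : AEMeasurable (fun ω => H ω p.1.1 p.1.2) P := by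
  have hs : (Real.sqrt N) ≠ 0 := by
    have : (0 : ℝ) < N := by exact_mod_cast hN
    positivity
  have := hW.probν
  have := hW.probν'
  rcases lt_or_eq_of_le p.2 with h | h
  · have h1 : AEMeasurable (fun ω => (Real.sqrt N : ℂ) * H ω p.1.1 p.1.2) P :=
      AEMeasurable.of_map_ne_zero (by rw [hW.offdiag _ _ h]; exact IsProbabilityMeasure.ne_zero _)
    have h2 := h1.const_mul ((Real.sqrt N : ℂ)⁻¹)
    refine h2.congr (Filter.Eventually.of_forall fun ω => ?_)
    have : (Real.sqrt N : ℂ) ≠ 0 := by exact_mod_cast hs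
    simp only []
    field_simp
  · have h1 : AEMeasurable (fun ω => Real.sqrt N * (H ω p.1.1 p.1.1).re) P :=
      AEMeasurable.of_map_ne_zero (by rw [hW.diag]; exact IsProbabilityMeasure.ne_zero _)
    have h2 := Complex.measurable_ofReal.comp_aemeasurable (h1.const_mul ((Real.sqrt N)⁻¹))
    refine h2.congr (Filter.Eventually.of_forall fun ω => ?_)
    rw [← h]
    simp only [Function.comp]
    rw [← mul_assoc, inv_mul_cancel₀ hs, one_mul]
    apply Complex.ext
    · simp
    · simp [hW.diag_real]

/-- index of the column entries -/
def pidx {n : ℕ} (i : Fin (n+1)) (k : Fin n) : UIdx (n+1) :=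
  if h : i.succAbove k < i then ⟨(i.succAbove k, i), h.le⟩ else ⟨(i, i.succAbove k), not_lt.1 h⟩

def gcol (N : ℕ) {n : ℕ} (i : Fin (n+1)) (k : Fin n) (x : ℂ) : ℂ :=
  if i.succAbove k < i then (Real.sqrt N : ℂ) * x else star ((Real.sqrt N : ℂ) * x)

lemma pidx_inj {n : ℕ} (i : Fin (n+1)) : Function.Injective (pidx i) := by
  intro k l h
  have hk := Fin.succAbove_ne i k
  have hl := Fin.succAbove_ne i l
  unfold pidx at h
  apply Fin.succAbove_right_injective (p := i)
  split_ifs at h with h1 h2 h2 <;> simp only [Subtype.mk.injEq, Prod.mk.injEq] at h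
  · exact h.1
  · exact absurd h.1 hk
  · exact absurd h.2 hk
  · exact h.2

lemma pidx_mem {n : ℕ} (i : Fin (n+1)) (k : Fin n) : (pidx i k).1.1 = i ∨ (pidx i k).1.2 = i := by
  unfold pidx; split_ifs <;> simp

def colLaw (ν : Measure ℂ) {n : ℕ} (i : Fin (n+1)) (k : Fin n) : Measure ℂ :=
  if i.succAbove k < i then ν else ν.map star

lemma gcol_eq {Ω : Type} [MeasurableSpace Ω] {P : Measure Ω} {n : ℕ}
    {H : Ω → Matrix (Fin (n+1)) (Fin (n+1)) ℂ} {ν : Measure ℂ} {ν' : Measure ℝ} (hW : IsWignerMatrix P (n+1) H ν ν')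
    (i : Fin (n+1)) (k : Fin n) (ω : Ω) :
    gcol (n+1) i k (H ω (pidx i k).1.1 (pidx i k).1.2) = (Real.sqrt ((n+1 : ℕ) : ℝ) : ℂ) * H ω (i.succAbove k) i := by
  unfold gcol pidx
  split_ifs with h
  · rfl
  · simp only
    rw [← (hW.herm ω).apply]
    simp

lemma measurable_gcol (N : ℕ) {n : ℕ} (i : Fin (n+1)) (k : Fin n) : Measurable (gcol N i k) := by
  unfold gcol
  split_ifs
  · fun_prop
  · exact Meas_star (by fun_prop : Measurable fun x : ℂ => (Real.sqrt N : ℂ) * x)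

lemma col_law {Ω : Type} [MeasurableSpace Ω] {P : Measure Ω} {n : ℕ}
    {H : Ω → Matrix (Fin (n+1)) (Fin (n+1)) ℂ} {ν : Measure ℂ} {ν' : Measure ℝ} (hW : IsWignerMatrix P (n+1) H ν ν')
    (i : Fin (n+1)) (k : Fin n) :
    P.map (fun ω => gcol (n+1) i k (H ω (pidx i k).1.1 (pidx i k).1.2)) = colLaw ν i k := by
  unfold gcol pidx colLaw
  have hms : Measurable (star : ℂ → ℂ) := continuous_star.measurable
  split_ifs with h
  · exact hW.offdiag _ _ h
  · have hlt : i < i.succAbove k := lt_of_le_of_ne (not_lt.1 h) (Fin.succAbove_ne i k).symm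
    have := hW.offdiag _ _ hlt
    rw [← this, AEMeasurable.map_map_of_aemeasurable hms.aemeasurable]
    · rfl
    · exact ((wig_entry_aem (Nat.succ_pos n) hW ⟨(i, i.succAbove k), hlt.le⟩).const_mul _)

lemma colLaw_prob (ν : Measure ℂ) [IsProbabilityMeasure ν] {n : ℕ} (i : Fin (n+1)) (k : Fin n) :
    IsProbabilityMeasure (colLaw ν i k) := by
  unfold colLaw; split_ifs
  · infer_instance
  · exact Measure.isProbabilityMeasure_map continuous_star.measurable.aemeasurable

def colv {Ω : Type} {n : ℕ} (H : Ω → Matrix (Fin (n+1)) (Fin (n+1)) ℂ) (i : Fin (n+1)) (ω : Ω) : Fin n → ℂ :=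
  fun k => (Real.sqrt ((n+1 : ℕ) : ℝ) : ℂ) * H ω (i.succAbove k) i

def minr {Ω : Type} {n : ℕ} (H : Ω → Matrix (Fin (n+1)) (Fin (n+1)) ℂ) (i : Fin (n+1)) (ω : Ω) : Fin n → Fin n → ℂ :=
  fun k l => H ω (i.succAbove k) (i.succAbove l)

lemma joint_law {Ω : Type} [MeasurableSpace Ω] {P : Measure Ω} {n : ℕ}
    {H : Ω → Matrix (Fin (n+1)) (Fin (n+1)) ℂ} {ν : Measure ℂ} {ν' : Measure ℝ} (hW : IsWignerMatrix P (n+1) H ν ν')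
    (i : Fin (n+1)) :
    AEMeasurable (fun ω => (minr H i ω, colv H i ω)) P ∧ AEMeasurable (minr H i) P ∧
    P.map (fun ω => (minr H i ω, colv H i ω)) = (P.map (minr H i)).prod (Measure.pi (colLaw ν i)) := by
  classical
  have := hW.prob
  have hX := wig_entry_aem (Nat.succ_pos n) hW
  set X : UIdx (n+1) → Ω → ℂ := fun p ω => H ω p.1.1 p.1.2 with hXd
  have hXi : iIndepFun X P := hW.indep
  -- column
  have hcolfun : colv H i = fun ω k => gcol (n+1) i k (X (pidx i k) ω) := by
    funext ω k; exact (gcol_eq hW i k ω).symm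
  have hgm : ∀ k, AEMeasurable (fun ω => gcol (n+1) i k (X (pidx i k) ω)) P := fun k =>
    (measurable_gcol (n+1) i k).comp_aemeasurable (hX (pidx i k))
  have hcol : P.map (colv H i) = Measure.pi (colLaw ν i) := by
    have h1 := (hXi.precomp (pidx_inj i)).comp (fun k => gcol (n+1) i k) (fun k => measurable_gcol _ _ _)
    have h2 := (iIndepFun_iff_map_fun_eq_pi_map hgm).1 h1
    rw [hcolfun, h2]
    congr 1; funext k; exact col_law hW i k
  have hcolm : AEMeasurable (colv H i) P := by
    rw [hcolfun]; exact aemeasurable_pi_lambda _ hgm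
  have hminm : AEMeasurable (minr H i) P := by
    refine aemeasurable_pi_lambda _ fun k => aemeasurable_pi_lambda _ fun l => ?_
    by_cases h : i.succAbove k ≤ i.succAbove l
    · exact hX ⟨(_, _), h⟩
    · have := (continuous_star (R := ℂ)).measurable.comp_aemeasurable (hX ⟨(i.succAbove l, i.succAbove k), (not_le.1 h).le⟩)
      refine this.congr (Filter.Eventually.of_forall fun ω => ?_)
      exact (hW.herm ω).apply _ _
  refine ⟨hminm.prodMk hcolm, hminm, ?_⟩
  rw [← hcol]
  refine (indepFun_iff_map_prod_eq_prod_map_map hminm hcolm).1 ?_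
  set S : Finset (UIdx (n+1)) := Finset.univ.filter fun p => ¬ (p.1.1 = i ∨ p.1.2 = i) with hS
  set T : Finset (UIdx (n+1)) := Finset.univ.filter fun p => (p.1.1 = i ∨ p.1.2 = i) with hT
  have hST : Disjoint S T := by
    rw [Finset.disjoint_left]; intro p hp hp'
    simp only [hS, hT, Finset.mem_filter] at hp hp'
    exact hp.2 hp'.2
  have hind := hXi.indepFun_finset₀ S T hST hX
  set φ : (S → ℂ) → (Fin n → Fin n → ℂ) := fun x k l =>
    if h : i.succAbove k ≤ i.succAbove l then
      x ⟨⟨(i.succAbove k, i.succAbove l), h⟩, by simp [hS, Fin.succAbove_ne]⟩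
    else star (x ⟨⟨(i.succAbove l, i.succAbove k), (not_le.1 h).le⟩, by simp [hS, Fin.succAbove_ne]⟩) with hφ
  set ψ : (T → ℂ) → (Fin n → ℂ) := fun x k => gcol (n+1) i k (x ⟨pidx i k, by simpa [hT] using pidx_mem i k⟩) with hψ
  have hφm : Measurable φ := by
    refine measurable_pi_lambda _ fun k => measurable_pi_lambda _ fun l => ?_
    simp only [hφ]
    split_ifs
    · exact measurable_pi_apply _
    · exact Meas_star (measurable_pi_apply _)
  have hψm : Measurable ψ := by
    refine measurable_pi_lambda _ fun k => ?_
    exact (measurable_gcol _ _ _).comp (measurable_pi_apply _)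
  have := hind.comp hφm hψm
  have e1 : minr H i = φ ∘ fun a (p : S) => X p a := by
    funext ω k l
    simp only [hφ, Function.comp, minr]
    split_ifs with h
    · rfl
    · exact ((hW.herm ω).apply _ _).symm
  have e2 : colv H i = ψ ∘ fun a (p : T) => X p a := by
    rw [hcolfun]; rfl
  rw [e1, e2]; exact this

lemma measurable_Rz {n : ℕ} (z : ℂ) (k l : Fin n) :
    Measurable fun B : Fin n → Fin n → ℂ => Rz (Matrix.of B) z k l := by
  have hc : Continuous fun B : Fin n → Fin n → ℂ => (Matrix.of B - z • (1 : Matrix (Fin n) (Fin n) ℂ)) := by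
    have : Continuous fun B : Fin n → Fin n → ℂ => (Matrix.of B : Matrix (Fin n) (Fin n) ℂ) := continuous_id
    exact this.sub continuous_const
  have h1 : Measurable fun B : Fin n → Fin n → ℂ => (Matrix.of B - z • (1 : Matrix (Fin n) (Fin n) ℂ)).det :=
    hc.matrix_det.measurable
  have h2 : Measurable fun B : Fin n → Fin n → ℂ => (Matrix.of B - z • (1 : Matrix (Fin n) (Fin n) ℂ)).adjugate k l :=
    (hc.matrix_adjugate.matrix_elem k l).measurable
  unfold Rz
  simp only [Matrix.inv_def, Ring.inverse_eq_inv', Matrix.smul_apply, smul_eq_mul]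
  exact h1.inv.mul h2

lemma event_col (C lam : ℝ) (hC : 0 < C) (hl : 0 < lam) (hlC : 2 * C * lam ≤ 1)
    {Ω : Type} [MeasurableSpace Ω] {P : Measure Ω} {n : ℕ}
    {H : Ω → Matrix (Fin (n+1)) (Fin (n+1)) ℂ} {ν : Measure ℂ} {ν' : Measure ℝ} (hW : IsWignerMatrix P (n+1) H ν ν')
    (hν : SGc ν C lam) (hνs : SGc (ν.map star) C lam)
    (i : Fin (n+1)) (z : ℂ) (hz : 0 < z.im) (M y t : ℝ) (ht0 : 0 < t) (ht1 : t ≤ 1)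
    (htM : t * M ≤ y / 4) :
    P {ω | (Rz ((H ω).submatrix i.succAbove i.succAbove) z).trace.im ≤ M * ((n : ℝ) + 1) ∧
      y < ‖star (fun k => H ω (i.succAbove k) i) ⬝ᵥ
      Rz ((H ω).submatrix i.succAbove i.succAbove) z *ᵥ (fun k => H ω (i.succAbove k) i)
        - (Rz ((H ω).submatrix i.succAbove i.succAbove) z).trace / ((n : ℂ) + 1)‖}
      ≤ 4 * ENNReal.ofReal (Real.exp (-(lam * t * y / 4 * (((n : ℝ) + 1) * z.im)))) := by
  have := hW.prob
  have := hW.probν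
  obtain ⟨hm, hmm, hlaw⟩ := joint_law hW i
  have : ∀ k, IsProbabilityMeasure (colLaw ν i k) := colLaw_prob ν i
  set S : Set ((Fin n → Fin n → ℂ) × (Fin n → ℂ)) := {x | (Matrix.of x.1).IsHermitian ∧
    (Rz (Matrix.of x.1) z).trace.im ≤ M * ((n : ℝ) + 1) ∧
    y * ((n : ℝ) + 1) < ‖star x.2 ⬝ᵥ Rz (Matrix.of x.1) z *ᵥ x.2 - (Rz (Matrix.of x.1) z).trace‖} with hS
  have hSm : MeasurableSet S := by
    have hR : ∀ k l, Measurable fun x : (Fin n → Fin n → ℂ) × (Fin n → ℂ) => Rz (Matrix.of x.1) z k l :=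
      fun k l => (measurable_Rz z k l).comp measurable_fst
    have ht : Measurable fun x : (Fin n → Fin n → ℂ) × (Fin n → ℂ) => (Rz (Matrix.of x.1) z).trace := by
      unfold Matrix.trace
      exact Finset.measurable_sum _ fun k _ => hR k k
    have hq : Measurable fun x : (Fin n → Fin n → ℂ) × (Fin n → ℂ) => star x.2 ⬝ᵥ Rz (Matrix.of x.1) z *ᵥ x.2 := by
      unfold dotProduct mulVec dotProduct
      refine Finset.measurable_sum _ fun k _ => ?_
      have hk : ∀ k, Measurable fun x : (Fin n → Fin n → ℂ) × (Fin n → ℂ) => x.2 k := fun k =>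
        (measurable_pi_apply k).comp measurable_snd
      refine Measurable.mul (Meas_star (hk k)) ?_
      exact Finset.measurable_sum _ fun l _ => (hR k l).mul (hk l)
    refine MeasurableSet.inter ?_ (MeasurableSet.inter ?_ ?_)
    · have : IsClosed {x : (Fin n → Fin n → ℂ) × (Fin n → ℂ) | (Matrix.of x.1).IsHermitian} := by
        have e : {x : (Fin n → Fin n → ℂ) × (Fin n → ℂ) | (Matrix.of x.1).IsHermitian} =
          ⋂ k, ⋂ l, {x | star (x.1 l k) = x.1 k l} := by
          ext x
          simp only [Set.mem_ofPred_eq, Set.mem_iInter]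
          exact Matrix.IsHermitian.ext_iff
        rw [e]
        refine isClosed_iInter fun k => isClosed_iInter fun l => isClosed_eq ?_ ?_ <;> fun_prop
      exact this.measurableSet
    · exact measurableSet_le (Complex.measurable_im.comp ht) measurable_const
    · exact measurableSet_lt measurable_const (hq.sub ht).norm
  have hNp : (0 : ℝ) < (n : ℝ) + 1 := by positivity
  have hsub : {ω | (Rz ((H ω).submatrix i.succAbove i.succAbove) z).trace.im ≤ M * ((n : ℝ) + 1) ∧
      y < ‖star (fun k => H ω (i.succAbove k) i) ⬝ᵥ
      Rz ((H ω).submatrix i.succAbove i.succAbove) z *ᵥ (fun k => H ω (i.succAbove k) i)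
        - (Rz ((H ω).submatrix i.succAbove i.succAbove) z).trace / ((n : ℂ) + 1)‖} ⊆
      (fun ω => (minr H i ω, colv H i ω)) ⁻¹' S := by
    rintro ω ⟨h1, h2⟩
    have eB : Matrix.of (minr H i ω) = (H ω).submatrix i.succAbove i.succAbove := rfl
    refine ⟨?_, ?_, ?_⟩
    · simp only [eB]; exact (hW.herm ω).submatrix _
    · simp only [eB]; exact h1
    · simp only [eB]
      set R := Rz ((H ω).submatrix i.succAbove i.succAbove) z
      set a : Fin n → ℂ := fun k => H ω (i.succAbove k) i
      have ea : colv H i ω = (Real.sqrt ((n+1 : ℕ) : ℝ) : ℂ) • a := rfl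
      have hsq : (Real.sqrt ((n+1 : ℕ) : ℝ) : ℂ) * (Real.sqrt ((n+1 : ℕ) : ℝ) : ℂ) = (n : ℂ) + 1 := by
        rw [← Complex.ofReal_mul, Real.mul_self_sqrt (by positivity)]; push_cast; rfl
      have e : star (colv H i ω) ⬝ᵥ R *ᵥ colv H i ω - R.trace = ((n : ℂ) + 1) * (star a ⬝ᵥ R *ᵥ a - R.trace / ((n : ℂ) + 1)) := by
        rw [ea, star_smul, mulVec_smul, smul_dotProduct, dotProduct_smul, smul_eq_mul, smul_eq_mul, ← mul_assoc,
          Complex.star_def, Complex.conj_ofReal, hsq]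
        have : (n : ℂ) + 1 ≠ 0 := by exact_mod_cast Nat.succ_ne_zero n
        field_simp
      rw [e, norm_mul]
      have : ‖(n : ℂ) + 1‖ = (n : ℝ) + 1 := by
        rw [show (n : ℂ) + 1 = (((n : ℝ) + 1 : ℝ) : ℂ) by push_cast; rfl, Complex.norm_real, Real.norm_of_nonneg hNp.le]
      rw [this, mul_comm]
      gcongr
  refine (measure_mono hsub).trans ((Measure.le_map_apply hm S).trans ?_)
  rw [hlaw, Measure.prod_apply hSm]
  have : IsProbabilityMeasure (P.map (minr H i)) := Measure.isProbabilityMeasure_map hmm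
  set b := 4 * ENNReal.ofReal (Real.exp (-(lam * t * y / 4 * (((n : ℝ) + 1) * z.im))))
  calc _ ≤ ∫⁻ _, b ∂(P.map (minr H i)) := by
        refine lintegral_mono fun B => ?_
        by_cases hB : (Matrix.of B).IsHermitian ∧ (Rz (Matrix.of B) z).trace.im ≤ M * ((n : ℝ) + 1)
        · refine (measure_mono ?_).trans (tail_fixed C lam hC hl hlC (colLaw ν i) inferInstance
            (fun k => ?_) (Matrix.of B) hB.1 z hz M y t ht0 ht1 htM hB.2)
          · intro v hv; exact hv.2.2
          · unfold colLaw; split_ifs <;> assumption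
        · have : Prod.mk B ⁻¹' S = ∅ := by
            rw [Set.eq_empty_iff_forall_notMem]; intro v hv
            exact hB ⟨hv.1, hv.2.1⟩
          simp only [this, measure_empty, zero_le]
    _ = b := by rw [lintegral_const, measure_univ, mul_one]

lemma event_diag {Ω : Type} [MeasurableSpace Ω] {P : Measure Ω} {n : ℕ}
    {H : Ω → Matrix (Fin (n+1)) (Fin (n+1)) ℂ} {ν : Measure ℂ} {ν' : Measure ℝ} (hW : IsWignerMatrix P (n+1) H ν ν')
    (δ₀ D' : ℝ) (hδ : 0 < δ₀) (hD : (∫⁻ x, ENNReal.ofReal (Real.exp (δ₀ * x ^ 2)) ∂ν') ≤ ENNReal.ofReal D')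
    (i : Fin (n+1)) (y : ℝ) (hy : 0 ≤ y) :
    P {ω | y < ‖H ω i i‖} ≤ ENNReal.ofReal D' * ENNReal.ofReal (Real.exp (-(δ₀ * y ^ 2 * ((n : ℝ) + 1)))) := by
  have := hW.probν'
  have hNp : (0 : ℝ) < (n : ℝ) + 1 := by positivity
  have hm : AEMeasurable (fun ω => Real.sqrt ((n+1 : ℕ) : ℝ) * (H ω i i).re) P :=
    AEMeasurable.of_map_ne_zero (by rw [hW.diag]; exact IsProbabilityMeasure.ne_zero _)
  set S : Set ℝ := {x | ENNReal.ofReal (Real.exp (δ₀ * y ^ 2 * ((n : ℝ) + 1))) ≤ ENNReal.ofReal (Real.exp (δ₀ * x ^ 2))} with hS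
  have hsub : {ω | y < ‖H ω i i‖} ⊆ (fun ω => Real.sqrt ((n+1 : ℕ) : ℝ) * (H ω i i).re) ⁻¹' S := by
    intro ω hω
    simp only [hS, Set.mem_preimage, Set.mem_ofPred_eq] at hω ⊢
    apply ENNReal.ofReal_le_ofReal
    apply Real.exp_le_exp.2
    rw [mul_pow, Real.sq_sqrt (by positivity)]
    have e : ‖H ω i i‖ = |(H ω i i).re| := by
      have : H ω i i = (((H ω i i).re : ℝ) : ℂ) := by
        apply Complex.ext
        · simp
        · simp [hW.diag_real]
      conv_lhs => rw [this]
      rw [Complex.norm_real, Real.norm_eq_abs]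
    rw [← sq_abs (H ω i i).re, ← e]
    push_cast
    rw [mul_assoc, mul_comm (y ^ 2)]
    gcongr
  refine (measure_mono hsub).trans ((Measure.le_map_apply hm S).trans ?_)
  rw [hW.diag]
  have hmk := mul_meas_ge_le_lintegral₀ (μ := ν') (f := fun x => ENNReal.ofReal (Real.exp (δ₀ * x ^ 2)))
    (by fun_prop) (ENNReal.ofReal (Real.exp (δ₀ * y ^ 2 * ((n : ℝ) + 1))))
  have h2 := hmk.trans hD
  set e := Real.exp (δ₀ * y ^ 2 * ((n : ℝ) + 1)) with he
  rw [Real.exp_neg, ← he, ENNReal.ofReal_inv_of_pos (Real.exp_pos _), ← div_eq_mul_inv, ENNReal.le_div_iff_mul_le]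
  · rw [mul_comm]; exact h2
  · left; simp [he, Real.exp_pos]
  · left; exact ENNReal.ofReal_ne_top
end

open MeasureTheory ProbabilityTheory
open scoped ENNReal NNReal
noncomputable section
open Matrix

lemma SGc_mono {ν : Measure ℂ} {C c0 lam : ℝ} (h : SGc ν C c0) (hl : lam ≤ c0) : SGc ν C lam :=
  fun a w ha => h a w (ha.trans hl)

lemma good_prob (δ₀ D D' M y : ℝ) (hM : 0 < M) (hy : 0 < y) :
    ∃ A b : ℝ, 0 < A ∧ 0 < b ∧ ∀ (n : ℕ) (Ω : Type) (_ : MeasurableSpace Ω) (P : Measure Ω)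
      (H : Ω → Matrix (Fin (n+1)) (Fin (n+1)) ℂ) (ν : Measure ℂ) (ν' : Measure ℝ),
      IsWignerMatrix P (n+1) H ν ν' → CondC1 ν ν' δ₀ D D' → ∀ (z : ℂ) (w : ℝ), 0 < w → w ≤ 1 → w ≤ z.im →
      P {ω | ¬ GoodAt (H ω) M y z} ≤ ENNReal.ofReal (((n : ℝ) + 1) * (A * Real.exp (-(b * (((n : ℝ) + 1) * w))))) := by
  by_cases hδ : 0 < δ₀
  swap
  · exact ⟨1, 1, one_pos, one_pos, fun n Ω _ P H ν ν' _ hC => absurd hC.1 hδ⟩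
  obtain ⟨C, c0, hC, hc0, hSG⟩ := SG_of_moment δ₀ D hδ
  set lam := min c0 (1 / (2 * C)) with hlam
  have hl : 0 < lam := lt_min hc0 (by positivity)
  have hlC : 2 * C * lam ≤ 1 := by
    calc 2 * C * lam ≤ 2 * C * (1 / (2 * C)) := by gcongr; exact min_le_right _ _
      _ = 1 := by field_simp
  set t := min 1 (y / (4 * M)) with ht
  have ht0 : 0 < t := lt_min one_pos (by positivity)
  have ht1 : t ≤ 1 := min_le_left _ _
  have htM : t * M ≤ y / 4 := by
    calc t * M ≤ y / (4 * M) * M := by gcongr; exact min_le_right _ _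
      _ = y / 4 := by field_simp
  set b := min (lam * t * y / 4) (δ₀ * y ^ 2) with hb
  have hbp : 0 < b := lt_min (by positivity) (by positivity)
  refine ⟨4 + |D'|, b, by positivity, hbp, ?_⟩
  intro n Ω _ P H ν ν' hW hC1 z w hw0 hw1 hwz
  have := hW.probν
  have := hW.prob
  have hz : 0 < z.im := hw0.trans_le hwz
  have hms : Measurable (star : ℂ → ℂ) := continuous_star.measurable
  have hν : SGc ν C lam := SGc_mono (hSG ν hW.probν hW.mean hW.var hC1.2.1) (min_le_left _ _)
  have hνs : SGc (ν.map star) C lam := by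
    refine SGc_mono (hSG (ν.map star) (Measure.isProbabilityMeasure_map hms.aemeasurable) ?_ ?_ ?_) (min_le_left _ _)
    · rw [integral_map hms.aemeasurable (by fun_prop)]
      have : ∫ z, (starRingEnd ℂ) z ∂ν = (starRingEnd ℂ) (∫ z, z ∂ν) := integral_conj
      rw [hW.mean, map_zero] at this
      exact this
    · rw [integral_map hms.aemeasurable (by fun_prop)]
      simp only [norm_star]; exact hW.var
    · rw [lintegral_map (by fun_prop) hms]
      simp only [norm_star]; exact hC1.2.1
  have hNp : (0 : ℝ) < (n : ℝ) + 1 := by positivity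
  set ex := Real.exp (-(b * (((n : ℝ) + 1) * w))) with hex
  set S1 : Fin (n+1) → Set Ω := fun i => {ω | y < ‖H ω i i‖}
  set S2 : Fin (n+1) → Set Ω := fun i => {ω | (Rz ((H ω).submatrix i.succAbove i.succAbove) z).trace.im ≤ M * ((n : ℝ) + 1) ∧
      y < ‖star (fun k => H ω (i.succAbove k) i) ⬝ᵥ
      Rz ((H ω).submatrix i.succAbove i.succAbove) z *ᵥ (fun k => H ω (i.succAbove k) i)
        - (Rz ((H ω).submatrix i.succAbove i.succAbove) z).trace / ((n : ℂ) + 1)‖}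
  have h1 : ∀ i, P (S1 i) ≤ ENNReal.ofReal (|D'| * ex) := by
    intro i
    refine (event_diag hW δ₀ D' hδ hC1.2.2 i y hy.le).trans ?_
    rw [ENNReal.ofReal_mul (abs_nonneg _)]
    gcongr
    · exact le_abs_self _
    · refine Real.exp_le_exp.2 (neg_le_neg ?_)
      calc b * (((n : ℝ) + 1) * w) ≤ (δ₀ * y ^ 2) * (((n : ℝ) + 1) * 1) := by
            gcongr; exact min_le_right _ _
        _ = _ := by ring
  have h2 : ∀ i, P (S2 i) ≤ ENNReal.ofReal (4 * ex) := by
    intro i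
    refine (event_col C lam hC hl hlC hW hν hνs i z hz M y t ht0 ht1 htM).trans ?_
    rw [ENNReal.ofReal_mul (by norm_num), show ENNReal.ofReal 4 = 4 by norm_num]
    gcongr
    refine Real.exp_le_exp.2 (neg_le_neg ?_)
    gcongr
    exact min_le_left _ _
  have hsub : {ω | ¬ GoodAt (H ω) M y z} ⊆ ⋃ i, (S1 i ∪ S2 i) := by
    intro ω hω
    simp only [Set.mem_ofPred_eq, GoodAt, not_forall] at hω
    obtain ⟨i, hi⟩ := hω
    rw [Set.mem_iUnion]
    refine ⟨i, ?_⟩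
    by_cases hh : ‖H ω i i‖ ≤ y
    · right
      rw [not_and] at hi
      have := hi hh
      rw [Classical.not_imp, not_le] at this
      exact this
    · left; exact not_le.1 hh
  calc _ ≤ P (⋃ i, (S1 i ∪ S2 i)) := measure_mono hsub
    _ ≤ ∑ i, P (S1 i ∪ S2 i) := measure_iUnion_fintype_le _ _
    _ ≤ ∑ i : Fin (n+1), ENNReal.ofReal ((4 + |D'|) * ex) := by
      refine Finset.sum_le_sum fun i _ => (measure_union_le _ _).trans ((add_le_add (h1 i) (h2 i)).trans ?_)
      rw [← ENNReal.ofReal_add (by positivity) (by positivity)]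
      apply le_of_eq; congr 1; ring
    _ = _ := by
      rw [Finset.sum_const, Finset.card_univ, Fintype.card_fin, nsmul_eq_mul, ENNReal.ofReal_mul hNp.le]
      congr 1
      rw [← ENNReal.ofReal_natCast]; push_cast; rfl
end

open MeasureTheory ProbabilityTheory
open scoped ENNReal NNReal
noncomputable section
open Matrix

lemma lip_aux (a b η : ℝ) (hη : 0 < η) : |η / (a ^ 2 + η ^ 2) - η / (b ^ 2 + η ^ 2)| ≤ |a - b| / η ^ 2 := by
  have hP : 0 < a ^ 2 + η ^ 2 := by positivity
  have hQ : 0 < b ^ 2 + η ^ 2 := by positivity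
  have e : η / (a ^ 2 + η ^ 2) - η / (b ^ 2 + η ^ 2) = (b - a) * (η * (a + b)) / ((a ^ 2 + η ^ 2) * (b ^ 2 + η ^ 2)) := by
    field_simp; ring
  rw [e, abs_div, abs_mul, abs_of_pos (mul_pos hP hQ), div_le_div_iff₀ (mul_pos hP hQ) (by positivity), abs_sub_comm b a, mul_assoc]
  refine mul_le_mul_of_nonneg_left ?_ (abs_nonneg _)
  have h1 : |η * (a + b)| ≤ ((a ^ 2 + η ^ 2) + (b ^ 2 + η ^ 2)) / 2 := by
    rw [abs_le]; constructor <;> nlinarith [sq_nonneg (a + η), sq_nonneg (b + η), sq_nonneg (a - η), sq_nonneg (b - η)]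
  have hP2 : η ^ 2 ≤ a ^ 2 + η ^ 2 := by nlinarith [sq_nonneg a]
  have hQ2 : η ^ 2 ≤ b ^ 2 + η ^ 2 := by nlinarith [sq_nonneg b]
  calc _ ≤ ((a ^ 2 + η ^ 2) + (b ^ 2 + η ^ 2)) / 2 * η ^ 2 := by gcongr
    _ = ((a ^ 2 + η ^ 2) * η ^ 2 + η ^ 2 * (b ^ 2 + η ^ 2)) / 2 := by ring
    _ ≤ ((a ^ 2 + η ^ 2) * (b ^ 2 + η ^ 2) + (a ^ 2 + η ^ 2) * (b ^ 2 + η ^ 2)) / 2 := by gcongr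
    _ = _ := by ring

lemma pim_lip {n : ℕ} {H : Matrix (Fin (n+1)) (Fin (n+1)) ℂ} (hH : H.IsHermitian) (x g η : ℝ) (hη : 0 < η) :
    |pim H x η - pim H g η| ≤ |x - g| / η ^ 2 := by
  have hNp : (0 : ℝ) < (n : ℝ) + 1 := by positivity
  rw [pim_eq hH x η hη, pim_eq hH g η hη, ← sub_div, ← Finset.sum_sub_distrib, abs_div, abs_of_pos hNp, div_le_iff₀ hNp]
  calc _ ≤ ∑ j, |η / ((hH.eigenvalues j - x) ^ 2 + η ^ 2) - η / ((hH.eigenvalues j - g) ^ 2 + η ^ 2)| :=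
        Finset.abs_sum_le_sum_abs _ _
    _ ≤ ∑ j : Fin (n+1), |x - g| / η ^ 2 := by
      refine Finset.sum_le_sum fun j _ => (lip_aux _ _ η hη).trans (le_of_eq ?_)
      rw [abs_sub_comm x g]; congr 2; ring
    _ = _ := by
      rw [Finset.sum_const, Finset.card_univ, Fintype.card_fin, nsmul_eq_mul]; push_cast; ring

lemma s0_lower (x σ : ℝ) (hσ : 0 < σ) (hσ2 : σ ≤ 1 / 2) (hx : |x| ≤ 2 - σ) : σ ≤ Real.sqrt (4 - x ^ 2) / 2 := by
  have : 2 * σ ≤ Real.sqrt (4 - x ^ 2) := by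
    apply Real.le_sqrt_of_sq_le
    rw [← sq_abs x]
    have := abs_nonneg x
    have h3 : σ * 2 ≤ (2 - |x|) * (2 + |x|) := by gcongr <;> linarith
    nlinarith
  linarith

lemma s0_lip (x E σ : ℝ) (hσ : 0 < σ) (hx : |x| ≤ 2) (hE : |E| ≤ 2) (h1 : σ ≤ Real.sqrt (4 - x ^ 2) / 2)
    (h2 : σ ≤ Real.sqrt (4 - E ^ 2) / 2) :
    |Real.sqrt (4 - x ^ 2) / 2 - Real.sqrt (4 - E ^ 2) / 2| ≤ |x - E| / (2 * σ) := by
  have ex : 0 ≤ 4 - x ^ 2 := by rw [← sq_abs x]; nlinarith [abs_nonneg x]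
  have eE : 0 ≤ 4 - E ^ 2 := by rw [← sq_abs E]; nlinarith [abs_nonneg E]
  have q1 := Real.sq_sqrt ex
  have q2 := Real.sq_sqrt eE
  set a := Real.sqrt (4 - x ^ 2) / 2
  set b := Real.sqrt (4 - E ^ 2) / 2
  have hab : (a - b) * (a + b) = (E - x) * ((E + x) / 4) := by
    have : (a - b) * (a + b) = (Real.sqrt (4 - x ^ 2) ^ 2 - Real.sqrt (4 - E ^ 2) ^ 2) / 4 := by ring
    rw [this, q1, q2]; ring
  rw [le_div_iff₀ (by positivity)]
  calc |a - b| * (2 * σ) ≤ |a - b| * |a + b| := by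
        gcongr
        rw [abs_of_pos (by linarith)]; linarith
    _ = |E - x| * |(E + x) / 4| := by rw [← abs_mul, hab, abs_mul]
    _ ≤ |E - x| * 1 := by
      gcongr
      rw [abs_div, abs_of_pos (by norm_num : (0 : ℝ) < 4), div_le_one (by norm_num)]
      exact (abs_add_le _ _).trans (by linarith)
    _ = |x - E| := by rw [mul_one, abs_sub_comm]

lemma grid_pt (Q : ℕ) (hQ : 0 < Q) (x : ℝ) (hx : |x| ≤ 2) :
    ∃ j ∈ Finset.Icc (-(2 * (Q : ℤ))) (2 * Q), |(j : ℝ) / Q| ≤ |x| ∧ |x - (j : ℝ) / Q| ≤ 1 / Q := by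
  have hQp : (0 : ℝ) < Q := by exact_mod_cast hQ
  have main : ∀ x : ℝ, 0 ≤ x → x ≤ 2 → ∃ m : ℕ, m ≤ 2 * Q ∧ (m : ℝ) / Q ≤ x ∧ x - (m : ℝ) / Q ≤ 1 / Q := by
    intro x h0 h2
    refine ⟨⌊x * Q⌋₊, ?_, ?_, ?_⟩
    · have : ((⌊x * Q⌋₊ : ℕ) : ℝ) ≤ x * Q := Nat.floor_le (by positivity)
      have h3 : ((⌊x * Q⌋₊ : ℕ) : ℝ) ≤ 2 * Q := this.trans (by gcongr)
      exact_mod_cast h3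
    · rw [div_le_iff₀ hQp]; exact Nat.floor_le (by positivity)
    · have := Nat.lt_floor_add_one (x * Q)
      rw [sub_le_iff_le_add, ← add_div, le_div_iff₀ hQp]; linarith
  obtain ⟨m, hm, h1, h2⟩ := main |x| (abs_nonneg _) hx
  have hmp : (0 : ℝ) ≤ (m : ℝ) / Q := by positivity
  rcases le_total 0 x with h | h
  · refine ⟨m, by rw [Finset.mem_Icc]; omega, ?_, ?_⟩
    · simpa [abs_of_nonneg hmp] using h1
    · rw [abs_of_nonneg h] at h1 h2
      push_cast
      rw [abs_of_nonneg (by linarith)]; exact h2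
  · refine ⟨-m, by rw [Finset.mem_Icc]; omega, ?_, ?_⟩
    · push_cast; rw [neg_div, abs_neg, abs_of_nonneg hmp]; exact h1
    · rw [abs_of_nonpos h] at h1 h2
      push_cast
      rw [neg_div, abs_of_nonpos (by linarith)]; linarith

lemma scale_ex (n : ℕ) (η η0 : ℝ) (hη : 0 < η) (hle : η ≤ η0) (h1 : η0 ≤ 1) (hN : 1 ≤ ((n : ℝ) + 1) * η) :
    ∃ k, k < n + 1 ∧ η0 / 2 ≤ 2 ^ k * η ∧ 2 ^ k * η ≤ η0 := by
  obtain ⟨k, hk1, hk2⟩ := exists_nat_pow_near (x := η0 / η) (y := 2) (by rwa [one_le_div hη]) (by norm_num)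
  rw [le_div_iff₀ hη] at hk1
  rw [div_lt_iff₀ hη, pow_succ] at hk2
  refine ⟨k, ?_, by linarith, hk1⟩
  have h3 : (2 : ℝ) ^ k * η ≤ ((n : ℝ) + 1) * η := by linarith
  have h4 : (2 : ℝ) ^ k ≤ (n : ℝ) + 1 := le_of_mul_le_mul_right h3 hη
  have h5 : 2 ^ k ≤ n + 1 := by exact_mod_cast h4
  exact lt_of_lt_of_le Nat.lt_two_pow_self h5

lemma near_lemma {n : ℕ} {H : Matrix (Fin (n+1)) (Fin (n+1)) ℂ} (hH : H.IsHermitian)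
    (E σ η0 y δ1 s e ηs d η : ℝ) (L : ℕ) (hL : 0 < L) (hE : |E| ≤ 2 - 2 * σ) (hσ : 0 < σ) (hσ2 : σ ≤ 1 / 2)
    (hη0 : 0 < η0) (hη01 : η0 ≤ 1) (hy1 : y ≤ 1) (hs0 : 0 < s) (hs1 : s ≤ η0 / 2) (hs2 : s ≤ σ / 4)
    (hys : 6 * y ≤ s) (he : 6 * y / s ≤ e) (hδ : (e + 2 * η0) / σ + η0 / 2 ≤ δ1) (hδ1 : δ1 ≤ σ / 2)
    (hηsσ : ηs ≤ σ) (hd : δ1 + 1 / L + (1 / L + ηs) / (2 * σ) ≤ d)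
    (hη : 0 < η) (hηle : η ≤ η0) (hNη : 1 ≤ y * (((n : ℝ) + 1) * η))
    (hG : ∀ j ∈ Finset.Icc (-(2 * ((L * (n + 1) ^ 2 : ℕ) : ℤ))) (2 * (L * (n + 1) ^ 2 : ℕ)), ∀ k < n + 1,
      GoodAt H (2 / η0 + 5) y ⟨(j : ℝ) / (L * (n + 1) ^ 2 : ℕ), 2 ^ k * η⟩) :
    ∀ x, |x - E| ≤ ηs → |pim H x η - Real.sqrt (4 - E ^ 2) / 2| ≤ d := by
  intro x hx
  set Q : ℕ := L * (n + 1) ^ 2 with hQ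
  have hQ0 : 0 < Q := by positivity
  have hLp : (0 : ℝ) < L := by exact_mod_cast hL
  have hNp : (0 : ℝ) < (n : ℝ) + 1 := by positivity
  have hQr : (Q : ℝ) = L * ((n : ℝ) + 1) ^ 2 := by rw [hQ]; push_cast; ring
  have hQL : (L : ℝ) ≤ Q := by
    rw [hQr]
    have : (1 : ℝ) ≤ ((n : ℝ) + 1) ^ 2 := one_le_pow₀ (by linarith [(Nat.cast_nonneg n : (0 : ℝ) ≤ n)])
    exact le_mul_of_one_le_right hLp.le this
  have hN1 : 1 ≤ ((n : ℝ) + 1) * η := hNη.trans (by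
    have : 0 < ((n : ℝ) + 1) * η := by positivity
    exact mul_le_of_le_one_left this.le hy1)
  have hxb : |x| ≤ 2 - σ := by
    have : |x| ≤ |x - E| + |E| := by
      have := abs_add_le (x - E) E
      rwa [sub_add_cancel] at this
    linarith
  obtain ⟨j, hj, hg1, hg2⟩ := grid_pt Q hQ0 x (by linarith)
  set g : ℝ := (j : ℝ) / Q with hg
  have hgb : |g| ≤ 2 - σ := hg1.trans hxb
  have hgs := s0_lower g σ hσ hσ2 hgb
  have hEs := s0_lower E σ hσ hσ2 (by linarith)
  obtain ⟨k, hk, hk1, hk2⟩ := scale_ex n η η0 hη hηle hη01 hN1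
  have h1 := scale_induct hH g σ η0 y δ1 s e (by linarith) hσ hgs hη0 hη01 hy1 hs0 hs1 hs2 hys he hδ hδ1 k η hη hNη hk1 hk2
    (fun j' hj' => hG j hj j' (lt_of_le_of_lt hj' hk))
  have h2 := pim_lip hH x g η hη
  have h3 := s0_lip g E σ hσ (by linarith) (by linarith) hgs hEs
  have hQinv : (1 : ℝ) / Q ≤ 1 / L := one_div_le_one_div_of_le hLp hQL
  have h4 : |x - g| / η ^ 2 ≤ 1 / L := by
    rw [div_le_iff₀ (by positivity)]
    calc |x - g| ≤ 1 / Q := hg2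
      _ = 1 / L * (1 / ((n : ℝ) + 1)) ^ 2 := by rw [hQr]; field_simp
      _ ≤ 1 / L * η ^ 2 := by
        gcongr
        rw [div_le_iff₀ hNp]; linarith
  have h5 : |g - E| ≤ 1 / L + ηs := by
    have := abs_sub_le g x E
    rw [abs_sub_comm g x] at this
    linarith
  have h6 : |g - E| / (2 * σ) ≤ (1 / L + ηs) / (2 * σ) := by gcongr
  have t1 := abs_sub_le (pim H x η) (pim H g η) (Real.sqrt (4 - E ^ 2) / 2)
  have t2 := abs_sub_le (pim H g η) (Real.sqrt (4 - g ^ 2) / 2) (Real.sqrt (4 - E ^ 2) / 2)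
  linarith

lemma det_main {n : ℕ} {H : Matrix (Fin (n+1)) (Fin (n+1)) ℂ} (hH : H.IsHermitian)
    (E σ η0 y δ1 s e ηs d τ : ℝ) (L : ℕ) (hL : 0 < L) (hE : |E| ≤ 2 - 2 * σ) (hσ : 0 < σ) (hσ2 : σ ≤ 1 / 2)
    (hη0 : 0 < η0) (hη01 : η0 ≤ 1) (hy0 : 0 < y) (hy1 : y ≤ 1) (hs0 : 0 < s) (hs1 : s ≤ η0 / 2) (hs2 : s ≤ σ / 4)
    (hys : 6 * y ≤ s) (he : 6 * y / s ≤ e) (hδ : (e + 2 * η0) / σ + η0 / 2 ≤ δ1) (hδ1 : δ1 ≤ σ / 2)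
    (hηsσ : ηs ≤ σ) (hd : δ1 + 1 / L + (1 / L + ηs) / (2 * σ) ≤ d) (hd0 : 0 ≤ d) (hd1 : d ≤ 1)
    (hτ : 0 < τ) (hτ4 : τ ≤ 1 / 4)
    (hηs : 0 < ηs) (hηle : ηs ≤ η0) (hNη : 1 ≤ y * (((n : ℝ) + 1) * (τ ^ 3 * ηs)))
    (hG : ∀ j ∈ Finset.Icc (-(2 * ((L * (n + 1) ^ 2 : ℕ) : ℤ))) (2 * (L * (n + 1) ^ 2 : ℕ)), ∀ k < n + 1,
      GoodAt H (2 / η0 + 5) y ⟨(j : ℝ) / (L * (n + 1) ^ 2 : ℕ), 2 ^ k * (τ ^ 3 * ηs)⟩ ∧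
      GoodAt H (2 / η0 + 5) y ⟨(j : ℝ) / (L * (n + 1) ^ 2 : ℕ), 2 ^ k * ηs⟩) :
    |(eigCount hH (Set.Icc (E - ηs / 2) (E + ηs / 2)) : ℝ) / (((n + 1 : ℕ) : ℝ) * ηs) - rhoSC E| ≤ d + 10 * τ := by
  classical
  have hτ3 : τ ^ 3 ≤ 1 := pow_le_one₀ hτ.le (by linarith)
  have hηl : τ ^ 3 * ηs ≤ ηs := mul_le_of_le_one_left hηs.le hτ3
  have hEn := abs_nonneg E
  have hE2 : |E| ≤ 2 := by linarith
  have hNη2 : 1 ≤ y * (((n : ℝ) + 1) * ηs) := hNη.trans (by gcongr)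
  have a1 := near_lemma hH E σ η0 y δ1 s e ηs d (τ ^ 3 * ηs) L hL hE hσ hσ2 hη0 hη01 hy1 hs0 hs1 hs2 hys he hδ hδ1 hηsσ hd
    (by positivity) (hηl.trans hηle) hNη (fun j hj k hk => (hG j hj k hk).1)
  have a2 := near_lemma hH E σ η0 y δ1 s e ηs d ηs L hL hE hσ hσ2 hη0 hη01 hy1 hs0 hs1 hs2 hys he hδ hδ1 hηsσ hd
    hηs hηle hNη2 (fun j hj k hk => (hG j hj k hk).2) E (by simpa using hηs.le)
  have hS1 : Real.sqrt (4 - E ^ 2) / 2 ≤ 1 := by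
    have : Real.sqrt (4 - E ^ 2) ≤ 2 := Real.sqrt_le_iff.2 ⟨by norm_num, by nlinarith [sq_nonneg E]⟩
    linarith
  have hc := count_lemma (Nat.succ_pos n) hH.eigenvalues τ ηs E (Real.sqrt (4 - E ^ 2) / 2) d hτ hτ4 hηs (by positivity) hS1
    hd0 hd1 (fun x hx => by
      have := a1 x hx
      rw [pim_eq hH x _ (by positivity)] at this
      push_cast
      exact this) (by
      rw [pim_eq hH E _ hηs] at a2
      push_cast
      linarith [(abs_le.1 a2).2]) (Finset.univ.filter fun i => hH.eigenvalues i ∈ Set.Icc (E - ηs / 2) (E + ηs / 2)) (by simp)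
  have hcard : (eigCount hH (Set.Icc (E - ηs / 2) (E + ηs / 2)) : ℝ) =
      ((Finset.univ.filter fun i => hH.eigenvalues i ∈ Set.Icc (E - ηs / 2) (E + ηs / 2)).card : ℝ) := by
    unfold eigCount; congr
  rw [hcard]
  have hpi := Real.pi_gt_three
  have hrho : rhoSC E = (Real.sqrt (4 - E ^ 2) / 2) / Real.pi := by
    unfold rhoSC; rw [if_pos hE2, div_div]
  rw [hrho]
  set q := ((Finset.univ.filter fun i => hH.eigenvalues i ∈ Set.Icc (E - ηs / 2) (E + ηs / 2)).card : ℝ) / (((n + 1 : ℕ) : ℝ) * ηs)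
  have e1 : q - (Real.sqrt (4 - E ^ 2) / 2) / Real.pi = (Real.pi * q - Real.sqrt (4 - E ^ 2) / 2) / Real.pi := by
    field_simp
  rw [e1, abs_div, abs_of_pos Real.pi_pos, div_le_iff₀ Real.pi_pos]
  refine hc.trans (le_mul_of_one_le_right (by positivity) (by linarith))
end

open MeasureTheory ProbabilityTheory
open scoped ENNReal NNReal
noncomputable section

lemma union_bd {Ω : Type} [MeasurableSpace Ω] (P : Measure Ω) (m L : ℕ) (S : Set Ω)
    (B1 B2 : ℤ → ℕ → Set Ω) (q : ℝ) (hq : 0 ≤ q) (hm : 0 < m) (hL : 0 < L)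
    (hS : ∀ ω ∈ S, ∃ j ∈ Finset.Icc (-(2*((L*m^2 : ℕ):ℤ))) (2*(L*m^2 : ℕ)), ∃ k < m, ω ∈ B1 j k ∨ ω ∈ B2 j k)
    (h1 : ∀ j k, P (B1 j k) ≤ ENNReal.ofReal q) (h2 : ∀ j k, P (B2 j k) ≤ ENNReal.ofReal q) :
    P S ≤ ENNReal.ofReal (10 * L * (m:ℝ)^3 * q) := by
  set J := Finset.Icc (-(2*((L*m^2 : ℕ):ℤ))) (2*(L*m^2 : ℕ)) with hJ
  have hsub : S ⊆ ⋃ p ∈ J ×ˢ Finset.range m, (B1 p.1 p.2 ∪ B2 p.1 p.2) := by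
    intro ω hω
    obtain ⟨j, hj, k, hk, h⟩ := hS ω hω
    simp only [Set.mem_iUnion]
    exact ⟨(j, k), Finset.mem_product.2 ⟨hj, Finset.mem_range.2 hk⟩, h⟩
  have hone : ∀ j k, P (B1 j k ∪ B2 j k) ≤ ENNReal.ofReal (2 * q) := by
    intro j k
    refine (measure_union_le _ _).trans ?_
    rw [two_mul, ENNReal.ofReal_add hq hq]
    exact add_le_add (h1 j k) (h2 j k)
  have hcard : ((J ×ˢ Finset.range m).card : ℝ) ≤ 5 * L * (m:ℝ)^3 := by
    have hJc : (J.card : ℝ) = 4 * (L * (m:ℝ)^2) + 1 := by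
      have : J.card = 4 * (L * m^2) + 1 := by
        rw [hJ, Int.card_Icc]; omega
      rw [this]; push_cast; ring
    rw [Finset.card_product, Finset.card_range]
    push_cast
    rw [hJc]
    have h1 : (1:ℝ) ≤ L := by exact_mod_cast hL
    have h2 : (1:ℝ) ≤ m := by exact_mod_cast hm
    have h3 : (1:ℝ) ≤ L * (m:ℝ)^2 := by nlinarith
    nlinarith
  calc P S ≤ P (⋃ p ∈ J ×ˢ Finset.range m, (B1 p.1 p.2 ∪ B2 p.1 p.2)) := measure_mono hsub
    _ ≤ ∑ p ∈ J ×ˢ Finset.range m, P (B1 p.1 p.2 ∪ B2 p.1 p.2) := measure_biUnion_finset_le _ _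
    _ ≤ ∑ p ∈ J ×ˢ Finset.range m, ENNReal.ofReal (2 * q) := Finset.sum_le_sum fun p _ => hone _ _
    _ = ENNReal.ofReal (((J ×ˢ Finset.range m).card : ℝ) * (2 * q)) := by
        rw [Finset.sum_const, nsmul_eq_mul, ENNReal.ofReal_mul (p := ((J ×ˢ Finset.range m).card : ℝ)) (by positivity), ENNReal.ofReal_natCast]
    _ ≤ _ := by
        apply ENNReal.ofReal_le_ofReal
        nlinarith [mul_le_mul_of_nonneg_right hcard hq]

lemma real_bd (A' a δ u N : ℝ) (hA' : 0 < A') (hu : 1 ≤ u) (hN : 0 < N)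
    (hlog : Real.log N ≤ u) (hau : A' + 4 + δ ≤ a * u) :
    A' * N ^ 4 * Real.exp (-(a * u ^ 2)) ≤ Real.exp (-(δ * u)) := by
  have h1 : A' ≤ Real.exp (A' * u) := by
    have := Real.add_one_le_exp (A' * u)
    nlinarith
  have h2 : N ^ 4 ≤ Real.exp (4 * u) := by
    have : N ≤ Real.exp u := by
      rw [← Real.exp_log hN]; exact Real.exp_le_exp.2 hlog
    calc N ^ 4 ≤ Real.exp u ^ 4 := pow_le_pow_left₀ hN.le this 4
      _ = _ := by rw [← Real.exp_nat_mul]; norm_num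
  calc A' * N ^ 4 * Real.exp (-(a * u ^ 2)) ≤ Real.exp (A' * u) * Real.exp (4 * u) * Real.exp (-(a * u ^ 2)) := by
        gcongr
    _ = Real.exp (A' * u + 4 * u - a * u ^ 2) := by rw [← Real.exp_add, ← Real.exp_add]; ring_nf
    _ ≤ _ := by
        apply Real.exp_le_exp.2
        nlinarith [mul_le_mul_of_nonneg_right hau (by linarith : (0:ℝ) ≤ u)]

/-- size facts for the square root scale -/
lemma u_facts (U N ηs : ℝ) (hU : 1 ≤ U) (hN : 2 ≤ N) (h : 16 * U ^ 2 * (Real.log N) ^ 4 / N ≤ ηs) :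
    0 < ηs ∧ U ≤ Real.sqrt (N * ηs) ∧ Real.log N ≤ Real.sqrt (N * ηs) ∧ Real.sqrt (N * ηs) ^ 2 = N * ηs := by
  have hl : 1 / 2 ≤ Real.log N := by
    have := Real.log_two_gt_d9
    have h2 := Real.log_le_log (by norm_num) hN
    linarith
  have hNp : 0 < N := by linarith
  have hη : 0 < ηs := lt_of_lt_of_le (by positivity) h
  have h2 : 16 * U ^ 2 * (Real.log N) ^ 4 ≤ N * ηs := by
    rw [div_le_iff₀ hNp] at h; linarith
  have h3 : 4 * U * (Real.log N) ^ 2 ≤ Real.sqrt (N * ηs) := by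
    apply Real.le_sqrt_of_sq_le
    calc _ = 16 * U ^ 2 * (Real.log N) ^ 4 := by ring
      _ ≤ _ := h2
  have h4 : 1 / 4 ≤ Real.log N ^ 2 := by nlinarith
  have h5 : Real.log N / 2 ≤ Real.log N ^ 2 := by nlinarith
  refine ⟨hη, ?_, ?_, Real.sq_sqrt (by positivity)⟩
  · nlinarith
  · nlinarith [mul_le_mul_of_nonneg_right hU (sq_nonneg (Real.log N))]

end

set_option maxHeartbeats 1000000 in
/-- **Semicircle law for the counting function on intermediate scales, uniform in the
energy.** -/
theorem stmt_12 :
    ∃ c₁ : ℝ, 0 < c₁ ∧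
    ∀ κ δ₀ D D' : ℝ, 0 < κ →
    ∃ C c c₂ : ℝ, 0 < C ∧ 0 < c ∧ 0 < c₂ ∧
    ∀ δ : ℝ, 0 < δ → δ ≤ c₁ * κ →
    ∃ Kδ : ℝ, 0 < Kδ ∧
    ∀ (N : ℕ) (Ω : Type) (_ : MeasurableSpace Ω) (P : Measure Ω)
      (H : Ω → Matrix (Fin N) (Fin N) ℂ) (ν : Measure ℂ) (ν' : Measure ℝ),
      2 ≤ N →
      ∀ (hW : IsWignerMatrix P N H ν ν'),
      CondC1 ν ν' δ₀ D D' →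
      ∀ ηs : ℝ, Kδ * (Real.log N) ^ 4 / N ≤ ηs → ηs ≤ c₂ * κ / Kδ →
        P {ω | δ ≤ ⨆ E ∈ Set.Icc (-(2 - κ)) (2 - κ),
            |(eigCount (hW.herm ω) (Set.Icc (E - ηs / 2) (E + ηs / 2)) : ℝ) / (N * ηs)
              - rhoSC E|}
          ≤ ENNReal.ofReal (C * Real.exp (-(c * δ * Real.sqrt (N * ηs)))) := by
  refine ⟨1, one_pos, fun κ δ₀ D D' hκ => ⟨1, 1, 1, one_pos, one_pos, one_pos, fun δ hδ _ => ?_⟩⟩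
  obtain ⟨σ, hσ, hσ2, hσκ⟩ : ∃ σ : ℝ, 0 < σ ∧ σ ≤ 1/2 ∧ 2 * σ ≤ κ :=
    ⟨min κ 1 / 2, by positivity, by linarith [min_le_right κ 1], by linarith [min_le_left κ 1]⟩
  obtain ⟨d0, hd0, hd1, hdδ⟩ : ∃ d0 : ℝ, 0 < d0 ∧ d0 ≤ 1 ∧ d0 ≤ δ :=
    ⟨min δ 1, by positivity, min_le_right _ _, min_le_left _ _⟩
  obtain ⟨δ1, hδ1, hδ1d, hδ1σ⟩ : ∃ δ1 : ℝ, 0 < δ1 ∧ δ1 ≤ d0 / 16 ∧ δ1 ≤ σ / 2 :=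
    ⟨min (d0/16) (σ/2), by positivity, min_le_left _ _, min_le_right _ _⟩
  obtain ⟨τ, hτ⟩ : ∃ τ, τ = d0 / 40 := ⟨_, rfl⟩
  obtain ⟨η0, hη0⟩ : ∃ η0, η0 = δ1 * σ / 8 := ⟨_, rfl⟩
  obtain ⟨e, he⟩ : ∃ e, e = δ1 * σ / 4 := ⟨_, rfl⟩
  obtain ⟨s, hs⟩ : ∃ s, s = η0 / 2 := ⟨_, rfl⟩
  obtain ⟨y, hy⟩ : ∃ y, y = s * e / 6 := ⟨_, rfl⟩
  have hδσ : 0 < δ1 * σ := by positivity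
  have hδσ1 : δ1 * σ ≤ σ / 4 := by nlinarith
  have hδσ2 : δ1 * σ ≤ δ1 := by nlinarith
  have hτ0 : 0 < τ := by rw [hτ]; positivity
  have hτ1 : τ ≤ 1/4 := by linarith
  have hη00 : 0 < η0 := by rw [hη0]; positivity
  have hη01 : η0 ≤ 1 := by linarith
  have he0 : 0 < e := by rw [he]; positivity
  have hs0 : 0 < s := by rw [hs]; positivity
  have hy0 : 0 < y := by rw [hy]; positivity
  have he1 : e ≤ 1 := by linarith
  have hs1 : s ≤ 1 := by linarith
  have h6y : 6 * y ≤ s := by rw [hy]; nlinarith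
  obtain ⟨L0, hL0⟩ := exists_nat_ge (64 / (d0 * σ))
  obtain ⟨L, hLp, hLb⟩ : ∃ L : ℕ, 0 < L ∧ 1 / (L:ℝ) ≤ d0 * σ / 64 := by
    refine ⟨L0 + 1, by omega, ?_⟩
    rw [div_le_iff₀ (by positivity)]
    rw [div_le_iff₀ (by positivity)] at hL0
    push_cast
    nlinarith [mul_pos hd0 hσ]
  obtain ⟨A, b, hA, hb, hP⟩ := good_prob δ₀ D D' (2/η0+5) y (by positivity) hy0
  obtain ⟨a, ha⟩ : ∃ a, a = b * τ ^ 3 := ⟨_, rfl⟩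
  have ha0 : 0 < a := by rw [ha]; positivity
  have hLr : (0:ℝ) < L := by exact_mod_cast hLp
  obtain ⟨A', hA'⟩ : ∃ A', A' = 10 * L * A := ⟨_, rfl⟩
  have hA'0 : 0 < A' := by rw [hA']; positivity
  obtain ⟨U, hU1, hUa, hUy, hUη, hUd⟩ : ∃ U : ℝ, 1 ≤ U ∧ (A' + 4 + δ) / a ≤ U ∧ 1 / (y * τ ^ 3) ≤ U ∧
      κ / η0 ≤ U ∧ 64 * κ / (d0 * σ) ≤ U := by
    have q1 : 0 < (A' + 4 + δ) / a := by positivity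
    have q2 : 0 < 1 / (y * τ ^ 3) := by positivity
    have q3 : 0 < κ / η0 := by positivity
    have q4 : 0 < 64 * κ / (d0 * σ) := by positivity
    refine ⟨1 + (A' + 4 + δ) / a + 1 / (y * τ ^ 3) + κ / η0 + 64 * κ / (d0 * σ), ?_, ?_, ?_, ?_, ?_⟩ <;> linarith
  refine ⟨16 * U ^ 2, by positivity, ?_⟩
  intro N Ω _ P H ν ν' hN hW hC ηs hη1 hη2
  obtain ⟨n, rfl⟩ : ∃ n, N = n + 1 := ⟨N - 1, by omega⟩
  have hNr : (2:ℝ) ≤ ((n + 1 : ℕ) : ℝ) := by exact_mod_cast hN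
  obtain ⟨hηp, hUu, hlogu, husq⟩ := u_facts U _ ηs hU1 hNr hη1
  set u := Real.sqrt (((n + 1 : ℕ) : ℝ) * ηs) with hu
  have hηU : ηs * U ≤ κ := by
    rw [le_div_iff₀ (by positivity)] at hη2
    have h16 : U ≤ 16 * U ^ 2 := by nlinarith only [hU1]
    linarith [mul_le_mul_of_nonneg_left h16 hηp.le]
  have hU0 : 0 < U := by linarith
  have hηη0 : ηs ≤ η0 := by
    rw [div_le_iff₀ hη00] at hUη
    refine le_of_mul_le_mul_right (a := U) ?_ hU0
    linarith
  have hηd : ηs ≤ d0 * σ / 64 := by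
    rw [div_le_iff₀ (by positivity)] at hUd
    refine le_of_mul_le_mul_right (a := U) ?_ hU0
    linarith
  have hu1 : 1 ≤ u := by linarith
  have huu : u ≤ u ^ 2 := by nlinarith only [hu1]
  have hd0σ : d0 * σ ≤ σ := by nlinarith only [hd1, hσ]
  have hd0σ' : d0 * σ ≤ d0 / 2 := by nlinarith only [hd0, hσ2]
  have hτ3 : τ ^ 3 ≤ 1 := pow_le_one₀ hτ0.le (by linarith)
  have hτ3p : 0 < τ ^ 3 := by positivity
  have hw : 0 < τ ^ 3 * ηs := by positivity
  have hw1 : τ ^ 3 * ηs ≤ 1 := mul_le_one₀ hτ3 hηp.le (by linarith)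
  have hwη : τ ^ 3 * ηs ≤ ηs := mul_le_of_le_one_left hηp.le hτ3
  have hcast : ((n + 1 : ℕ) : ℝ) = (n:ℝ) + 1 := by push_cast; ring
  have hNη : 1 ≤ y * (((n:ℝ) + 1) * (τ ^ 3 * ηs)) := by
    have : 1 / (y * τ ^ 3) ≤ u ^ 2 := by linarith
    rw [husq, div_le_iff₀ (by positivity), hcast] at this
    linarith
  have hpow : ∀ (k : ℕ) (x : ℝ), 0 ≤ x → x ≤ 2 ^ k * x := by
    intro k x hx
    have : (1:ℝ) ≤ 2 ^ k := one_le_pow₀ (by norm_num)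
    exact le_mul_of_one_le_left hx this
  have hq0 : 0 ≤ ((n : ℝ) + 1) * (A * Real.exp (-(b * (((n : ℝ) + 1) * (τ ^ 3 * ηs))))) := by positivity
  have key := union_bd P (n+1) L {ω | δ ≤ ⨆ E ∈ Set.Icc (-(2 - κ)) (2 - κ),
            |(eigCount (hW.herm ω) (Set.Icc (E - ηs / 2) (E + ηs / 2)) : ℝ) / ((n + 1 : ℕ) * ηs)
              - rhoSC E|}
      (fun j k => {ω | ¬ GoodAt (H ω) (2/η0+5) y ⟨(j:ℝ)/(L*(n+1)^2 : ℕ), 2^k*(τ^3*ηs)⟩})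
      (fun j k => {ω | ¬ GoodAt (H ω) (2/η0+5) y ⟨(j:ℝ)/(L*(n+1)^2 : ℕ), 2^k*ηs⟩}) _ hq0
      (Nat.succ_pos n) hLp ?_
      (fun j k => hP n Ω _ P H ν ν' hW hC _ (τ^3*ηs) hw hw1 (hpow k _ hw.le))
      (fun j k => hP n Ω _ P H ν ν' hW hC _ (τ^3*ηs) hw hw1 (hwη.trans (hpow k _ hηp.le)))
  · refine key.trans (ENNReal.ofReal_le_ofReal ?_)
    have hau : A' + 4 + δ ≤ a * u := by
      rw [div_le_iff₀ ha0] at hUa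
      linarith [mul_le_mul_of_nonneg_left hUu ha0.le]
    have := real_bd A' a δ u _ hA'0 hu1 (by linarith) hlogu hau
    rw [one_mul, one_mul]
    refine le_trans (le_of_eq ?_) this
    rw [husq, hA', ha, hcast]
    have : b * (((n:ℝ) + 1) * (τ ^ 3 * ηs)) = b * τ ^ 3 * (((n:ℝ) + 1) * ηs) := by ring
    rw [this]; ring
  · intro ω hω
    by_contra hcon
    push Not at hcon
    have hG : ∀ j ∈ Finset.Icc (-(2*((L*(n+1)^2 : ℕ):ℤ))) (2*(L*(n+1)^2 : ℕ)), ∀ k < n+1,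
        GoodAt (H ω) (2/η0+5) y ⟨(j:ℝ)/(L*(n+1)^2 : ℕ), 2^k*(τ^3*ηs)⟩ ∧
        GoodAt (H ω) (2/η0+5) y ⟨(j:ℝ)/(L*(n+1)^2 : ℕ), 2^k*ηs⟩ := by
      intro j hj k hk
      have := hcon j hj k hk
      simpa only [Set.mem_ofPred_eq, not_not] using this
    have hle : (⨆ E ∈ Set.Icc (-(2 - κ)) (2 - κ),
            |(eigCount (hW.herm ω) (Set.Icc (E - ηs / 2) (E + ηs / 2)) : ℝ) / ((n + 1 : ℕ) * ηs)
              - rhoSC E|) ≤ δ / 2 := by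
      refine Real.iSup_le (fun E => Real.iSup_le (fun hE => ?_) (by linarith)) (by linarith)
      have hEσ : |E| ≤ 2 - 2 * σ := by
        rw [abs_le]; constructor <;> linarith [hE.1, hE.2]
      have h1 : (e + 2 * η0) / σ + η0 / 2 ≤ δ1 := by
        have : (e + 2 * η0) / σ = δ1 / 2 := by rw [he, hη0]; field_simp; ring
        rw [this]; linarith
      have h2 : 6 * y / s ≤ e := by
        rw [div_le_iff₀ hs0, hy]; linarith
      have h3 : δ1 + 1 / (L:ℝ) + (1 / (L:ℝ) + ηs) / (2 * σ) ≤ d0 / 8 := by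
        have : (1 / (L:ℝ) + ηs) / (2 * σ) ≤ d0 / 64 := by
          rw [div_le_iff₀ (by positivity)]; linarith
        linarith
      have := det_main (hW.herm ω) E σ η0 y δ1 s e ηs (d0/8) τ L hLp hEσ hσ hσ2 hη00 hη01 hy0 (by linarith) hs0
        (by linarith) (by linarith) h6y h2 h1 hδ1σ (by linarith) h3 (by linarith) (by linarith) hτ0 hτ1 hηp hηη0 hNη hG
      linarith
    have : δ ≤ _ := hω
    linarith

end
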